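/- For every real number b > 0 and every integer d ≥ 2 there exists a constant c(b,d) with the following property: for every prime p > d, every prime power q = p^m, every N ≥ 1, and every polynomial F ∈ F_q[x_1,…,x_N] of degree d with rank R(F) > c(b,d), the bias satisfies B(F) ≤ b. -/

import Mathlib

open MvPolynomial

/-- The rank of a homogeneous polynomial `G` of degree `d`: the minimal `r` such that
`G = ∑_{i=1}^r Q_i · P_i` with `deg Q_i < d` and `deg P_i < d`. -/
noncomputable def homRank {K : Type*} [Field K] {σ : Type*} (d : ℕ) (G : MvPolynomial σ K) : ℕ :=
  sInf {r : ℕ | ∃ Q P : Fin r → MvPolynomial σ K,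
    (∀ i, (Q i).totalDegree < d ∧ (P i).totalDegree < d) ∧ G = ∑ i, Q i * P i}

/-- The rank `R(F)` of a polynomial `F` of degree `d` over a finite field: the rank of the
degree-`d` homogeneous part of `F`, viewed over the algebraic closure. -/
noncomputable def polyRank {K : Type*} [Field K] {N : ℕ} (d : ℕ)
    (F : MvPolynomial (Fin N) K) : ℕ :=
  homRank d (MvPolynomial.map (algebraMap K (AlgebraicClosure K)) (homogeneousComponent d F))

/-- The degree-`n` extension `k_n` of `F_q`, `q = p^m`, realized inside a fixed algebraic
closure as the fixed field of the `(m·n)`-fold iterated Frobenius `x ↦ x^(p^(m·n))`. -/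
noncomputable def kn (p m : ℕ) [Fact p.Prime] (n : ℕ) :
    Subfield (AlgebraicClosure (GaloisField p m)) :=
  RingHom.eqLocusField (iterateFrobenius (AlgebraicClosure (GaloisField p m)) p (m * n))
    (RingHom.id _)

/-- `μ_n^F(t) = #{v ∈ k_n^N : F(v) = t} / q^(nN)`, where `q = p^m`. -/
noncomputable def muF {p m : ℕ} [Fact p.Prime] {N : ℕ}
    (F : MvPolynomial (Fin N) (GaloisField p m)) (n : ℕ) (t : kn p m n) : ℝ :=
  (Nat.card {v : Fin N → kn p m n //
      eval (fun i => ((v i : AlgebraicClosure (GaloisField p m))))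
        (MvPolynomial.map (algebraMap (GaloisField p m) (AlgebraicClosure (GaloisField p m))) F)
        = (t : AlgebraicClosure (GaloisField p m))}) / (p : ℝ) ^ (m * n * N)

/-- `b_n = −log_{q^n}( max_{t,s ∈ k_n} |μ_n^F(t) − μ_n^F(s)| )`, where `q = p^m`. -/
noncomputable def biasSeq {p m : ℕ} [Fact p.Prime] {N : ℕ}
    (F : MvPolynomial (Fin N) (GaloisField p m)) (n : ℕ) : ℝ :=
  - Real.logb ((p : ℝ) ^ (m * n)) (⨆ t : kn p m n, ⨆ s : kn p m n, |muF F n t - muF F n s|)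

/-- The bias `B(F) = limsup_{n → ∞} b_n⁻¹`. -/
noncomputable def bias {p m : ℕ} [Fact p.Prime] {N : ℕ}
    (F : MvPolynomial (Fin N) (GaloisField p m)) : ℝ :=
  Filter.limsup (fun n => (biasSeq F n)⁻¹) Filter.atTop

set_option linter.unusedSectionVars false


noncomputable def ML {σ : Type*} [Fintype σ] {R : Type*} [CommRing R] :
    (m : ℕ) → MvPolynomial σ R → (σ → R) → MultilinearMap R (fun _ : Fin m => σ → R) R
  | 0, F, x => MultilinearMap.constOfIsEmpty R _ (∑ i, x i * constantCoeff (pderiv i F))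
  | m + 1, F, x => ∑ i, LinearMap.uncurryLeft
      ((LinearMap.proj i : (σ → R) →ₗ[R] R).smulRight (ML m (pderiv i F) x))

section MLsec
variable {σ : Type*} [Fintype σ] {R : Type*} [CommRing R]

lemma ML_zero (F : MvPolynomial σ R) (x : σ → R) (w : Fin 0 → σ → R) :
    ML 0 F x w = ∑ i, x i * constantCoeff (pderiv i F) := by
  simp [ML]

lemma ML_succ (m : ℕ) (F : MvPolynomial σ R) (x : σ → R) (w : Fin (m+1) → σ → R) :
    ML (m+1) F x w = ∑ i, w 0 i * ML m (pderiv i F) x (Fin.tail w) := by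
  simp [ML]

lemma ML_add (m : ℕ) (F G : MvPolynomial σ R) (x : σ → R) (w : Fin m → σ → R) :
    ML m (F + G) x w = ML m F x w + ML m G x w := by
  induction m generalizing F G with
  | zero => simp [ML_zero, mul_add, Finset.sum_add_distrib]
  | succ m ih => simp [ML_succ, mul_add, Finset.sum_add_distrib, ih]

lemma ML_smul (m : ℕ) (c : R) (F : MvPolynomial σ R) (x : σ → R) (w : Fin m → σ → R) :
    ML m (C c * F) x w = c * ML m F x w := by
  induction m generalizing F with
  | zero => simp [ML_zero, Finset.mul_sum, mul_left_comm]
  | succ m ih => simp [ML_succ, Finset.mul_sum, ih, mul_left_comm]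

lemma ML_sum {ι : Type*} (s : Finset ι) (m : ℕ) (F : ι → MvPolynomial σ R) (x : σ → R)
    (w : Fin m → σ → R) :
    ML m (∑ i ∈ s, F i) x w = ∑ i ∈ s, ML m (F i) x w := by
  classical
  induction s using Finset.induction_on with
  | empty => simpa using ML_smul m 0 0 x w
  | insert a s ha ih => rw [Finset.sum_insert ha, Finset.sum_insert ha, ML_add, ih]

lemma ML_x (m : ℕ) (F : MvPolynomial σ R) (x : σ → R) (w : Fin m → σ → R) [DecidableEq σ] :
    ML m F x w = ∑ l, x l * ML m F (Pi.single l 1) w := by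
  induction m generalizing F with
  | zero => simp [ML_zero, Pi.single_apply]
  | succ m ih =>
    simp only [ML_succ, Finset.mul_sum]
    rw [Finset.sum_comm]
    refine Finset.sum_congr rfl fun i _ => ?_
    rw [ih, Finset.mul_sum]
    refine Finset.sum_congr rfl fun l _ => ?_
    ring

lemma ML_map {S : Type*} [CommRing S] (φ : R →+* S) (m : ℕ) (F : MvPolynomial σ R) (x : σ → R)
    (w : Fin m → σ → R) :
    ML m (map φ F) (fun i => φ (x i)) (fun j i => φ (w j i)) = φ (ML m F x w) := by
  induction m generalizing F with
  | zero => simp [ML_zero, pderiv_map, constantCoeff_map]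
  | succ m ih =>
    simp only [ML_succ, map_sum, map_mul, pderiv_map]
    refine Finset.sum_congr rfl fun i _ => ?_
    rw [← ih]; rfl

lemma ML_euler (m : ℕ) (F : MvPolynomial σ R) (hF : F.IsHomogeneous (m+1)) (x : σ → R) :
    ML m F x (fun _ => x) = ((m+1).factorial : R) * eval x F := by
  induction m generalizing F with
  | zero =>
    have h := congrArg (eval x) hF.sum_X_mul_pderiv
    simp only [map_sum, map_mul, eval_X, nsmul_eq_mul, map_natCast] at h
    rw [ML_zero]
    simp only [zero_add, Nat.factorial_one]
    rw [zero_add] at h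
    rw [← h]
    refine Finset.sum_congr rfl fun i _ => ?_
    have : (pderiv i F).IsHomogeneous 0 := hF.pderiv
    obtain ⟨c, hc⟩ : ∃ c, pderiv i F = C c :=
      ⟨_, totalDegree_eq_zero_iff_eq_C.1 (Nat.le_zero.1 this.totalDegree_le)⟩
    simp [hc]
  | succ m ih =>
    have h := congrArg (eval x) hF.sum_X_mul_pderiv
    simp only [map_sum, map_mul, eval_X, nsmul_eq_mul, map_natCast] at h
    rw [ML_succ, Nat.factorial_succ, Nat.cast_mul, mul_right_comm, ← h, Finset.sum_mul]
    refine Finset.sum_congr rfl fun i _ => ?_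
    have := ih (pderiv i F) hF.pderiv
    change x i * (ML m ((pderiv i) F) x) (fun _ => x) = _
    rw [this]
    ring

/-- all monomials have degree `< n` -/
def PD (n : ℕ) (F : MvPolynomial σ R) : Prop := F ∈ restrictSupport R {s : σ →₀ ℕ | s.degree < n}

lemma PD_add {n : ℕ} {F G : MvPolynomial σ R} (hF : PD n F) (hG : PD n G) : PD n (F + G) :=
  Submodule.add_mem _ hF hG
lemma PD_mono {n n' : ℕ} (h : n ≤ n') {F : MvPolynomial σ R} (hF : PD n F) : PD n' F :=
  restrictSupport_mono R (fun s (hs : s.degree < n) => lt_of_lt_of_le hs h) hF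
lemma PD_iff {n : ℕ} {F : MvPolynomial σ R} : PD n F ↔ ∀ s, coeff s F ≠ 0 → s.degree < n := by
  rw [PD, mem_restrictSupport_iff]
  constructor
  · intro h s hs
    exact h (by simpa using hs)
  · intro h s hs
    exact h s (by simpa using hs)

/-- linear operators can be checked on monomials -/
lemma PD_ind {n : ℕ} {F : MvPolynomial σ R} (hF : PD n F) (p : MvPolynomial σ R → Prop)
    (h0 : p 0) (hadd : ∀ F G, p F → p G → p (F + G))
    (hm : ∀ s a, s.degree < n → p (monomial s a)) : p F := by
  classical
  rw [F.as_sum]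
  apply Finset.sum_induction _ p hadd h0
  intro s hs
  exact hm s _ (PD_iff.1 hF s (by simpa using hs))

lemma PD_pderiv {n : ℕ} {F : MvPolynomial σ R} (hF : PD (n+1) F) (i : σ) : PD n (pderiv i F) := by
  apply PD_ind hF (fun F => PD n (pderiv i F))
  · simp [PD]
  · intro F G h1 h2; rw [map_add]; exact PD_add h1 h2
  · intro s a hs
    rw [pderiv_monomial, PD_iff]
    intro t ht
    classical
    rw [coeff_monomial] at ht
    split_ifs at ht with h
    · subst h
      have : s i ≠ 0 := by rintro h; simp [h] at ht
      have h1 : s - Finsupp.single i 1 + Finsupp.single i 1 = s :=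
        tsub_add_cancel_of_le (by simpa [Nat.one_le_iff_ne_zero] using this)
      have h2 := congrArg Finsupp.degree h1
      rw [map_add, Finsupp.degree_single] at h2
      omega
    · exact absurd rfl ht

lemma PD_X_mul {n : ℕ} {F : MvPolynomial σ R} (hF : PD n F) (i : σ) : PD (n+1) (X i * F) := by
  apply PD_ind hF (fun F => PD (n+1) (X i * F))
  · simp [PD]
  · intro F G h1 h2; rw [mul_add]; exact PD_add h1 h2
  · intro s a hs
    rw [X, monomial_mul, PD_iff]
    intro t ht
    classical
    rw [coeff_monomial] at ht
    split_ifs at ht with h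
    · subst h
      rw [map_add, Finsupp.degree_single]; omega
    · exact absurd rfl ht

lemma PD_C_mul {n : ℕ} {F : MvPolynomial σ R} (hF : PD n F) (c : R) : PD n (C c * F) := by
  rw [← smul_eq_C_mul]; exact Submodule.smul_mem _ _ hF

lemma ML_PD (m : ℕ) (F : MvPolynomial σ R) (hF : PD (m+1) F) (x : σ → R) (w : Fin m → σ → R) :
    ML m F x w = 0 := by
  induction m generalizing F with
  | zero =>
    rw [ML_zero]
    refine Finset.sum_eq_zero fun i _ => ?_
    have := PD_pderiv hF i
    have h0 : pderiv i F = 0 := by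
      ext s
      by_contra h
      exact absurd (PD_iff.1 this s (by simpa using h)) (by omega)
    simp [h0]
  | succ m ih =>
    rw [ML_succ]
    refine Finset.sum_eq_zero fun i _ => ?_
    rw [ih _ (PD_pderiv hF i), mul_zero]

noncomputable def shiftP (h : σ → R) : MvPolynomial σ R →ₐ[R] MvPolynomial σ R :=
  bind₁ (fun i => X i + C (h i))

noncomputable def dirD (h : σ → R) (F : MvPolynomial σ R) : MvPolynomial σ R :=
  ∑ i, C (h i) * pderiv i F

lemma dirD_X_mul (h : σ → R) (i : σ) (F : MvPolynomial σ R) :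
    dirD h (X i * F) = C (h i) * F + X i * dirD h F := by
  classical
  simp only [dirD, Derivation.leibniz, smul_eq_mul, mul_add, Finset.sum_add_distrib, Finset.mul_sum]
  rw [add_comm]
  congr 1
  · simp [pderiv_X, Pi.single_apply, mul_comm]
  · exact Finset.sum_congr rfl fun j _ => by ring

lemma PD_zero_iff {F : MvPolynomial σ R} : PD 0 F ↔ F = 0 := by
  constructor
  · intro h; ext s
    by_contra hc
    exact absurd (PD_iff.1 h s (by simpa using hc)) (by omega)
  · rintro rfl; simp [PD]

lemma dirD_add (h : σ → R) (F G : MvPolynomial σ R) : dirD h (F + G) = dirD h F + dirD h G := by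
  simp [dirD, mul_add, Finset.sum_add_distrib]

lemma shift_PD_mon (h : σ → R) (n : ℕ) : ∀ (s : σ →₀ ℕ) (a : R), s.degree = n →
      PD n (shiftP h (monomial s a) - monomial s a) ∧
      PD (n-1) (shiftP h (monomial s a) - monomial s a - dirD h (monomial s a)) := by
  classical
  induction n with
  | zero =>
    intro s a hn
    have hs : s = 0 := (Finsupp.degree_eq_zero_iff s).1 hn
    subst hs
    have : shiftP h (monomial 0 a) - monomial 0 a = 0 := by simp [shiftP]
    have h2 : dirD h (monomial (0 : σ →₀ ℕ) a) = 0 := by simp [dirD]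
    rw [this, h2]; simp [PD]
  | succ n ih =>
    intro s a hn
    have hs : s ≠ 0 := by rintro rfl; simp at hn
    obtain ⟨i, hi⟩ := Finsupp.ne_iff.1 hs
    have h1 : Finsupp.single i 1 + (s - Finsupp.single i 1) = s :=
      add_tsub_cancel_of_le (by simpa [Nat.one_le_iff_ne_zero] using hi)
    set t := s - Finsupp.single i 1 with ht
    have h2 : t.degree = n := by
      have := congrArg Finsupp.degree h1
      rw [map_add, Finsupp.degree_single] at this
      omega
    have h3 : monomial s a = X i * monomial t a := by
      rw [← h1, X, monomial_mul, one_mul]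
    obtain ⟨ih1, ih2⟩ := ih t a h2
    set g := monomial t a with hg
    have hgP : PD (n+1) g := by
      rw [PD_iff]; intro u hu
      rw [hg, coeff_monomial] at hu
      split_ifs at hu with h
      · subst h; omega
      · exact absurd rfl hu
    have e1 : shiftP h (X i * g) = (X i + C (h i)) * shiftP h g := by
      simp [shiftP]
    rw [h3, e1, dirD_X_mul]
    constructor
    · have : (X i + C (h i)) * shiftP h g - X i * g
        = X i * (shiftP h g - g) + (C (h i) * g + C (h i) * (shiftP h g - g)) := by ring
      rw [this]
      exact PD_add (PD_X_mul ih1 i) (PD_add (PD_C_mul hgP _)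
        (PD_C_mul (PD_mono (Nat.le_succ n) ih1) _))
    · have : (X i + C (h i)) * shiftP h g - X i * g - (C (h i) * g + X i * dirD h g)
        = X i * (shiftP h g - g - dirD h g) + C (h i) * (shiftP h g - g) := by ring
      rw [this, Nat.add_sub_cancel]
      refine PD_add ?_ (PD_C_mul ih1 _)
      rcases n with _ | n
      · rw [PD_zero_iff.1 ih2]; simp [PD]
      · exact PD_X_mul ih2 i

lemma shift_PD (h : σ → R) {n : ℕ} {F : MvPolynomial σ R} (hF : PD (n+1) F) :
    PD n (shiftP h F - F) ∧ PD (n-1) (shiftP h F - F - dirD h F) := by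
  apply PD_ind hF (fun F => PD n (shiftP h F - F) ∧ PD (n-1) (shiftP h F - F - dirD h F))
  · simp [PD, dirD]
  · rintro F G ⟨h1, h2⟩ ⟨h3, h4⟩
    rw [map_add, dirD_add]
    constructor
    · convert PD_add h1 h3 using 1; ring
    · convert PD_add h2 h4 using 1; ring
  · intro s a hs
    have := shift_PD_mon h _ s a rfl
    exact ⟨PD_mono (by omega) this.1, PD_mono (by omega) this.2⟩

lemma eval_shiftP (h x : σ → R) (F : MvPolynomial σ R) :
    eval x (shiftP h F) = eval (x + h) F := by
  have : (eval x).comp (shiftP h).toRingHom = eval (x + h) := by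
    apply MvPolynomial.ringHom_ext
    · intro r; simp [shiftP]
    · intro i; simp [shiftP]
  exact congrArg (fun f => f F) this

lemma ML_shift (m : ℕ) (F : MvPolynomial σ R) (hF : PD (m+3) F) (h : σ → R) (x : σ → R)
    (w : Fin m → σ → R) :
    ML m (shiftP h F - F) x w = ML (m+1) F x (Fin.cons h w) := by
  have h1 := (shift_PD h hF).2
  have h2 := ML_PD m _ h1 x w
  have h3 : shiftP h F - F = (shiftP h F - F - dirD h F) + dirD h F := by ring
  rw [h3, ML_add, h2, zero_add, ML_succ, dirD, ML_sum]
  refine Finset.sum_congr rfl fun i _ => ?_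
  rw [ML_smul]; simp

end MLsec

section weyl
variable {σ : Type*} [Fintype σ] [DecidableEq σ] {k : Type*} [Field k] [Fintype k]

noncomputable def expS (ψ : AddChar k ℂ) (F : MvPolynomial σ k) : ℝ :=
  ‖∑ v : σ → k, ψ (eval v F)‖ / (Fintype.card (σ → k) : ℝ)

lemma expS_nonneg (ψ : AddChar k ℂ) (F : MvPolynomial σ k) : 0 ≤ expS ψ F := by
  unfold expS; positivity

def Zs (m : ℕ) (F : MvPolynomial σ k) : Set (Fin m → σ → k) := {w | ∀ x, ML m F x w = 0}

lemma linear_PD (F : MvPolynomial σ k) (hF : PD 2 F) (v : σ → k) :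
    eval v F = constantCoeff F + ∑ i, v i * constantCoeff (pderiv i F) := by
  apply PD_ind hF (fun F => eval v F = constantCoeff F + ∑ i, v i * constantCoeff (pderiv i F))
  · simp
  · intro F G h1 h2
    simp only [map_add, h1, h2, mul_add, Finset.sum_add_distrib]; ring
  · intro s a hs
    by_cases h0 : s = 0
    · subst h0
      simp
    · obtain ⟨i, hi⟩ := Finsupp.ne_iff.1 h0
      have h1 : Finsupp.single i 1 + (s - Finsupp.single i 1) = s :=
        add_tsub_cancel_of_le (by simpa [Nat.one_le_iff_ne_zero] using hi)
      have h2 : (s - Finsupp.single i 1).degree = 0 := by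
        have := congrArg Finsupp.degree h1
        rw [map_add, Finsupp.degree_single] at this
        omega
      rw [Finsupp.degree_eq_zero_iff] at h2
      rw [h2, add_zero] at h1
      subst h1
      have : monomial (Finsupp.single i 1) a = C a * X i := by
        rw [C_mul_X_eq_monomial]
      rw [this]
      simp [pderiv_X, Pi.single_apply, mul_comm, apply_ite constantCoeff]

lemma weyl (ψ : AddChar k ℂ) (hψ : ψ ≠ 1) (m : ℕ) (F : MvPolynomial σ k) (hF : PD (m+2) F) :
    expS ψ F ^ (2^m) ≤ Nat.card (Zs m F) / (Fintype.card (σ → k) : ℝ)^m := by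
  classical
  have hS : (0:ℝ) < (Fintype.card (σ → k) : ℝ) := by exact_mod_cast Fintype.card_pos
  induction m generalizing F with
  | zero =>
    by_cases h : ∀ x, ML 0 F x Fin.elim0 = 0
    · have : Zs 0 F = Set.univ := by
        ext w; simp only [Zs, Set.mem_ofPred_eq, Set.mem_univ, iff_true]
        intro x; rw [Subsingleton.elim w Fin.elim0]; exact h x
      rw [this]
      simp only [pow_zero, pow_one, div_one, Nat.card_unique, Nat.cast_one]
      unfold expS
      rw [div_le_one hS]
      refine (norm_sum_le _ _).trans ?_
      simp
    · push Not at h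
      obtain ⟨x0, hx0⟩ := h
      rw [ML_zero] at hx0
      let ℓ : (σ → k) →+ k :=
        { toFun := fun v => ∑ i, v i * constantCoeff (pderiv i F)
          map_zero' := by simp
          map_add' := by intro x y; simp [add_mul, Finset.sum_add_distrib] }
      have hne : ψ.compAddMonoidHom ℓ ≠ 1 := by
        rw [AddChar.ne_one_iff] at hψ ⊢
        obtain ⟨a, ha⟩ := hψ
        refine ⟨fun i => a / (∑ i, x0 i * constantCoeff (pderiv i F)) * x0 i, ?_⟩
        have : ℓ (fun i => a / (∑ i, x0 i * constantCoeff (pderiv i F)) * x0 i) = a := by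
          change ∑ i, _ = a
          simp only [mul_assoc, ← Finset.mul_sum]
          rw [div_mul_cancel₀ _ hx0]
        simpa [this] using ha
      have h1 := AddChar.sum_eq_zero_of_ne_one hne
      have : ∑ v : σ → k, ψ (eval v F) = 0 := by
        have : ∀ v : σ → k, ψ (eval v F) = ψ (constantCoeff F) * (ψ.compAddMonoidHom ℓ) v := by
          intro v
          rw [linear_PD F hF v, AddChar.map_add_eq_mul]; rfl
        simp_rw [this, ← Finset.mul_sum, h1, mul_zero]
      rw [expS, this]
      simp
  | succ m ih =>
    set S : ℝ := (Fintype.card (σ → k) : ℝ) with hSdef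
    -- squaring
    have key : ((‖∑ v : σ → k, ψ (eval v F)‖^2 : ℝ) : ℂ) =
        ∑ h : σ → k, ∑ x : σ → k, ψ (eval x (shiftP h F - F)) := by
      rw [← Complex.normSq_eq_norm_sq, ← Complex.mul_conj, map_sum, Finset.sum_mul_sum,
        Finset.sum_comm]
      rw [Finset.sum_comm (s := (Finset.univ : Finset (σ → k)))
        (f := fun h x => ψ (eval x (shiftP h F - F)))]
      refine Finset.sum_congr rfl fun x _ => ?_
      rw [← Equiv.sum_comp (Equiv.addLeft x)]
      refine Finset.sum_congr rfl fun h _ => ?_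
      rw [map_sub, eval_shiftP, AddChar.map_sub_eq_div, div_eq_mul_inv]
      congr 1
      exact (AddChar.inv_apply_eq_conj ψ _).symm
    have sq : expS ψ F ^ 2 ≤ ∑ h : σ → k, S⁻¹ * expS ψ (shiftP h F - F) := by
      have h1 : ‖∑ v : σ → k, ψ (eval v F)‖^2 ≤
          ∑ h : σ → k, ‖∑ x : σ → k, ψ (eval x (shiftP h F - F))‖ := by
        have := congrArg norm key
        rw [Complex.norm_real, Real.norm_of_nonneg (by positivity)] at this
        rw [this]
        exact norm_sum_le _ _
      unfold expS
      rw [← hSdef, div_pow, ← Finset.mul_sum, ← Finset.sum_div, sq S, ← div_div, inv_mul_eq_div]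
      gcongr
    have pm := Real.pow_arith_mean_le_arith_mean_pow Finset.univ (fun _ : σ → k => S⁻¹)
      (fun h => expS ψ (shiftP h F - F)) (fun _ _ => by positivity)
      (by rw [Finset.sum_const, Finset.card_univ, nsmul_eq_mul, ← hSdef]; field_simp)
      (fun _ _ => expS_nonneg _ _) (2^m)
    have hcard : (Nat.card (Zs (m+1) F) : ℝ) =
        ∑ h : σ → k, (Nat.card (Zs m (shiftP h F - F)) : ℝ) := by
      rw [← Nat.cast_sum]
      congr 1
      rw [← Nat.card_sigma]
      refine Nat.card_congr ?_
      refine ⟨fun w => ⟨w.1 0, ⟨Fin.tail w.1, fun x => ?_⟩⟩,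
        fun z => ⟨Fin.cons z.1 z.2.1, fun x => ?_⟩, fun w => ?_, fun z => ?_⟩
      · rw [ML_shift _ _ hF, Fin.cons_self_tail]; exact w.2 x
      · rw [← ML_shift _ _ hF]; exact z.2.2 x
      · ext1; exact Fin.cons_self_tail _
      · rfl
    calc expS ψ F ^ (2^(m+1)) = (expS ψ F ^ 2)^(2^m) := by rw [← pow_mul, pow_succ, mul_comm]
      _ ≤ (∑ h : σ → k, S⁻¹ * expS ψ (shiftP h F - F))^(2^m) := by gcongr
      _ ≤ _ := pm
      _ ≤ ∑ h : σ → k, S⁻¹ * (Nat.card (Zs m (shiftP h F - F)) / S^m) := by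
          refine Finset.sum_le_sum fun h _ => ?_
          gcongr
          exact ih _ (shift_PD h hF).1
      _ = _ := by
          rw [hcard, ← Finset.mul_sum, ← Finset.sum_div]
          field_simp
          ring

/-- distribution deviation from exponential sums -/
lemma dev_fourier (F : MvPolynomial σ k) (ε : ℝ)
    (hε : ∀ ψ : AddChar k ℂ, ψ ≠ 1 → expS ψ F ≤ ε) (t : k) :
    |(Nat.card {v : σ → k // eval v F = t} : ℝ) / (Fintype.card (σ → k) : ℝ)
      - 1 / Fintype.card k| ≤ ε := by
  classical
  have hS : (0:ℝ) < (Fintype.card (σ → k) : ℝ) := by exact_mod_cast Fintype.card_pos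
  have hQ : (0:ℝ) < (Fintype.card k : ℝ) := by exact_mod_cast Fintype.card_pos
  set S : ℝ := (Fintype.card (σ → k) : ℝ) with hSdef
  set Q : ℝ := (Fintype.card k : ℝ) with hQdef
  have h1 : ((Nat.card {v : σ → k // eval v F = t} : ℝ) : ℂ) * (Q : ℂ) =
      ∑ ψ : AddChar k ℂ, ∑ v : σ → k, ψ (eval v F - t) := by
    rw [Finset.sum_comm]
    simp_rw [AddChar.sum_apply_eq_ite, sub_eq_zero]
    rw [← Finset.sum_filter, Finset.sum_const, nsmul_eq_mul, Nat.card_eq_fintype_card,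
      Fintype.card_subtype]
    simp [hQdef]
  have h2 : ((Nat.card {v : σ → k // eval v F = t} * Q - S : ℝ) : ℂ) =
      ∑ ψ ∈ (Finset.univ : Finset (AddChar k ℂ)).erase 1, ∑ v : σ → k, ψ (eval v F - t) := by
    rw [← Finset.add_sum_erase _ _ (Finset.mem_univ (1 : AddChar k ℂ))] at h1
    push_cast at h1 ⊢
    rw [h1]
    simp [hSdef]
  have h3 : |Nat.card {v : σ → k // eval v F = t} * Q - S| ≤ Q * (ε * S) := by
    have := congrArg norm h2
    rw [Complex.norm_real, Real.norm_eq_abs] at this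
    rw [this]
    refine (norm_sum_le _ _).trans ?_
    have hb : ∀ ψ ∈ (Finset.univ : Finset (AddChar k ℂ)).erase 1,
        ‖∑ v : σ → k, ψ (eval v F - t)‖ ≤ ε * S := by
      intro ψ hψ
      have := hε ψ (Finset.ne_of_mem_erase hψ)
      rw [expS, div_le_iff₀ hS] at this
      refine le_trans (le_of_eq ?_) this
      simp_rw [sub_eq_add_neg, AddChar.map_add_eq_mul, ← Finset.sum_mul]
      rw [norm_mul, AddChar.norm_apply, mul_one]
    refine (Finset.sum_le_card_nsmul _ _ _ hb).trans ?_
    rw [nsmul_eq_mul]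
    have hε0 : 0 ≤ ε * S ∨ ((Finset.univ : Finset (AddChar k ℂ)).erase 1) = ∅ := by
      rcases Finset.eq_empty_or_nonempty ((Finset.univ : Finset (AddChar k ℂ)).erase 1) with h | ⟨ψ, h⟩
      · right; exact h
      · left; exact (norm_nonneg _).trans (hb ψ h)
    rcases hε0 with h | h
    · gcongr
      rw [hQdef]
      have := Finset.card_erase_le (s := (Finset.univ : Finset (AddChar k ℂ))) (a := 1)
      have h' : (Finset.univ : Finset (AddChar k ℂ)).card = Fintype.card k := by
        rw [Finset.card_univ]; exact AddChar.card_eq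
      exact_mod_cast h' ▸ this
    · exfalso
      obtain ⟨ψ, hψ⟩ := AddChar.exists_apply_ne_zero.2 (one_ne_zero (α := k))
      have : ψ ∈ (Finset.univ : Finset (AddChar k ℂ)).erase 1 := by
        simp only [Finset.mem_erase, Finset.mem_univ, and_true]
        rintro rfl; simp at hψ
      rw [h] at this; simp at this
  have h4 : (Nat.card {v : σ → k // eval v F = t} : ℝ) / S - 1 / Q =
    (Nat.card {v : σ → k // eval v F = t} * Q - S) / (Q * S) := by field_simp
  rw [h4, abs_div, abs_of_pos (mul_pos hQ hS), div_le_iff₀ (mul_pos hQ hS)]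
  linarith

end weyl


section SLsec
variable {R : Type*} [AddCommGroup R]

def SL (P : R → Prop) (n : ℕ) (y : R) : Prop :=
  ∃ l : List R, l.length ≤ n ∧ (∀ z ∈ l, P z) ∧ l.sum = y

lemma SL_zero (P : R → Prop) (n : ℕ) : SL P n 0 := ⟨[], by simp, by simp, by simp⟩
lemma SL_one {P : R → Prop} {y : R} (h : P y) : SL P 1 y := ⟨[y], by simp, by simpa, by simp⟩
lemma SL_mono {P P' : R → Prop} {n n' : ℕ} {y : R} (h : SL P n y) (hn : n ≤ n')
    (hP : ∀ z, P z → P' z) : SL P' n' y := by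
  obtain ⟨l, h1, h2, h3⟩ := h
  exact ⟨l, h1.trans hn, fun z hz => hP z (h2 z hz), h3⟩
lemma SL_add {P : R → Prop} {n n' : ℕ} {y y' : R} (h : SL P n y) (h' : SL P n' y') :
    SL P (n + n') (y + y') := by
  obtain ⟨l, h1, h2, h3⟩ := h
  obtain ⟨l', h1', h2', h3'⟩ := h'
  refine ⟨l ++ l', by simp; omega, fun z hz => ?_, by simp [h3, h3']⟩
  rcases List.mem_append.1 hz with h | h
  exacts [h2 z h, h2' z h]
lemma SL_sum {P : R → Prop} {n : ℕ} {ι : Type*} (s : Finset ι) (f : ι → R)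
    (h : ∀ i ∈ s, SL P n (f i)) : SL P (s.card * n) (∑ i ∈ s, f i) := by
  classical
  induction s using Finset.induction_on with
  | empty => simpa using SL_zero P 0
  | insert a s ha ih =>
    rw [Finset.sum_insert ha, Finset.card_insert_of_notMem ha, add_mul, one_mul, add_comm _ n]
    exact SL_add (h a (by simp)) (ih fun i hi => h i (by simp [hi]))
lemma SL_bind {P P' : R → Prop} {n n' : ℕ} {y : R} (φ : R →+ R) (h : SL P n y)
    (hP : ∀ z, P z → SL P' n' (φ z)) : SL P' (n * n') (φ y) := by
  obtain ⟨l, h1, h2, rfl⟩ := h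
  suffices SL P' (l.length * n') (φ l.sum) from SL_mono this (by gcongr) fun _ h => h
  clear h1
  induction l with
  | nil => simpa using SL_zero P' 0
  | cons a l ih =>
    rw [List.sum_cons, List.length_cons, add_mul, one_mul, add_comm _ n', map_add]
    exact SL_add (hP a (h2 a (by simp))) (ih fun z hz => h2 z (by simp [hz]))
end SLsec

section der
variable {σ : Type*} {K : Type*} [Field K] {L : Type*} [Field L] [Algebra K L]

noncomputable def cfun (δ : L →+ L) (f : MvPolynomial σ L) : MvPolynomial σ L :=
  ∑ s ∈ f.support, monomial s (δ (coeff s f))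

lemma coeff_cfun (δ : L →+ L) (f : MvPolynomial σ L) (s : σ →₀ ℕ) :
    coeff s (cfun δ f) = δ (coeff s f) := by
  classical
  unfold cfun
  rw [coeff_sum]
  simp only [coeff_monomial]
  rw [Finset.sum_ite_eq']
  split_ifs with h
  · rfl
  · rw [notMem_support_iff.1 h, map_zero]

noncomputable def mapDer (δ : Derivation K L L) :
    Derivation K (MvPolynomial σ L) (MvPolynomial σ L) :=
  Derivation.mk'
    { toFun := cfun (δ : L →ₗ[K] L).toAddMonoidHom
      map_add' := by intro f g; ext s; simp [coeff_cfun]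
      map_smul' := by intro c f; ext s; simp [coeff_cfun] }
    (by
      classical
      intro f g
      ext s
      simp only [LinearMap.coe_mk, AddHom.coe_mk, coeff_cfun, coeff_add, smul_eq_mul]
      rw [coeff_mul, coeff_mul, mul_comm g, coeff_mul, map_sum, ← Finset.sum_add_distrib]
      refine Finset.sum_congr rfl fun x _ => ?_
      simp [coeff_cfun, mul_comm])

lemma coeff_mapDer (δ : Derivation K L L) (f : MvPolynomial σ L) (s : σ →₀ ℕ) :
    coeff s (mapDer δ f) = δ (coeff s f) := coeff_cfun _ f s

lemma mapDer_C (δ : Derivation K L L) (c : L) : mapDer (σ := σ) δ (C c) = C (δ c) := by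
  classical
  ext s; rw [coeff_mapDer, coeff_C, coeff_C]; split_ifs <;> simp

lemma mapDer_X (δ : Derivation K L L) (i : σ) : mapDer (σ := σ) δ (X i) = 0 := by
  classical
  ext s; rw [coeff_mapDer, coeff_X]; split_ifs <;> simp

lemma mapDer_deg (δ : Derivation K L L) (f : MvPolynomial σ L) :
    (mapDer δ f).totalDegree ≤ f.totalDegree := by
  apply totalDegree_le_of_support_subset
  intro s hs
  rw [mem_support_iff, coeff_mapDer] at hs
  rw [mem_support_iff]
  intro h; rw [h] at hs; simp at hs

/-- the tangent data -/
def Tan (K : Type*) [Field K] {L : Type*} [Field L] [Algebra K L] {m : ℕ} [DecidableEq σ]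
    (ξ : Fin m → σ → L) (g : ℕ) : Prop :=
  ∀ j, ∃ (δ : σ → Derivation K L L) (lam f : Fin g → σ → L),
    (∀ k j', j' ≠ j → ∀ i, δ k (ξ j' i) = 0) ∧
    ∀ k i, δ k (ξ j i) + ∑ a, lam a k * f a i = if i = k then 1 else 0

lemma TanR [Fintype σ] [DecidableEq σ] {m g : ℕ} {ξ : Fin m → σ → L} (hT : Tan K ξ g) (j : Fin m)
    (w : σ → MvPolynomial σ L) (a : ℕ) (hw : ∀ i, (w i).totalDegree ≤ a) :
    ∃ D : Derivation K (MvPolynomial σ L) (MvPolynomial σ L),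
      (∀ f, (D f).totalDegree ≤ f.totalDegree + a) ∧ (∀ i, D (X i) = 0) ∧
      (∀ j', j' ≠ j → ∀ i, D (C (ξ j' i)) = 0) ∧
      ∃ (Λ : Fin g → MvPolynomial σ L) (f : Fin g → σ → L), (∀ b, (Λ b).totalDegree ≤ a) ∧
        ∀ i, w i = D (C (ξ j i)) + ∑ b, Λ b * C (f b i) := by
  obtain ⟨δ, lam, f, h1, h2⟩ := hT j
  have hD : ∀ p, (∑ k, w k • mapDer (σ := σ) (δ k)) p = ∑ k, w k * mapDer (δ k) p := by
    intro p
    change Derivation.coeFnAddMonoidHom (∑ k, w k • mapDer (σ := σ) (δ k)) p = _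
    rw [map_sum, Finset.sum_apply]; rfl
  refine ⟨∑ k, w k • mapDer (δ k), fun p => ?_, fun i => ?_, fun j' hj' i => ?_,
    fun b => ∑ k, w k * C (lam b k), f, fun b => ?_, fun i => ?_⟩
  · rw [hD]
    refine totalDegree_finsetSum_le fun k _ => ?_
    refine (totalDegree_mul _ _).trans ?_
    have := mapDer_deg (δ k) p
    have := hw k
    omega
  · rw [hD]; simp [mapDer_X]
  · rw [hD]; simp [mapDer_C, h1 _ j' hj' i]
  · refine totalDegree_finsetSum_le fun k _ => ?_
    refine (totalDegree_mul _ _).trans ?_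
    rw [totalDegree_C]
    exact hw k
  · rw [hD]
    simp only [mapDer_C, Finset.sum_mul]
    rw [Finset.sum_comm, ← Finset.sum_add_distrib]
    have : ∀ k, w k * C (δ k (ξ j i)) + ∑ b, w k * C (lam b k) * C (f b i) =
        w k * (if i = k then 1 else 0) := by
      intro k
      have h := congrArg (C (σ := σ)) (h2 k i)
      rw [map_add, map_sum] at h
      simp only [mul_assoc, ← Finset.mul_sum, ← mul_add, ← map_mul]
      rw [h]
      split_ifs <;> simp
    rw [Finset.sum_congr rfl fun k _ => this k]
    simp

lemma ML_der [Fintype σ] {R : Type*} [CommRing R] [Algebra K R] (D : Derivation K R R) (m : ℕ)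
    (G : MvPolynomial σ K) (x : σ → R) (hx : ∀ i, D (x i) = 0) (w : Fin m → σ → R) :
    D (ML m (map (algebraMap K R) G) x w) =
      ∑ j, ML m (map (algebraMap K R) G) x (Function.update w j fun i => D (w j i)) := by
  induction m generalizing G with
  | zero => simp [ML_zero, pderiv_map, constantCoeff_map, hx]
  | succ m ih =>
    rw [ML_succ, map_sum, Fin.sum_univ_succ]
    simp only [Derivation.leibniz, smul_eq_mul, pderiv_map, ML_succ]
    rw [Finset.sum_add_distrib, add_comm]
    congr 1
    · refine Finset.sum_congr rfl fun i _ => ?_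
      rw [Fin.tail_update_zero, Function.update_self, mul_comm]
    · rw [Finset.sum_comm]
      refine Finset.sum_congr rfl fun i _ => ?_
      rw [ih, Finset.mul_sum]
      refine Finset.sum_congr rfl fun j _ => ?_
      rw [Fin.tail_update_succ, Function.update_of_ne (Fin.succ_ne_zero j).symm]
      rfl

lemma ML_deg [Fintype σ] (m : ℕ) (G : MvPolynomial σ K) (w : Fin m → σ → MvPolynomial σ L)
    (a : Fin m → ℕ) (hw : ∀ j i, (w j i).totalDegree ≤ a j) :
    (ML m (map (algebraMap K (MvPolynomial σ L)) G) X w).totalDegree ≤ 1 + ∑ j, a j := by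
  induction m generalizing G with
  | zero =>
    rw [ML_zero]
    refine totalDegree_finsetSum_le fun i _ => ?_
    refine (totalDegree_mul _ _).trans ?_
    rw [pderiv_map, constantCoeff_map, IsScalarTower.algebraMap_apply K L (MvPolynomial σ L),
      algebraMap_eq, totalDegree_C, totalDegree_X]
    omega
  | succ m ih =>
    rw [ML_succ]
    refine totalDegree_finsetSum_le fun i _ => ?_
    refine (totalDegree_mul _ _).trans ?_
    rw [pderiv_map]
    have := ih (pderiv i G) (Fin.tail w) (fun j => a j.succ) (fun j i => hw j.succ i)
    have h0 := hw 0 i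
    rw [Fin.sum_univ_succ]
    omega

end der


section schmidt
variable {σ : Type*} [Fintype σ] [DecidableEq σ] {K : Type*} [Field K] {L : Type*} [Field L]
  [Algebra K L]

/-- the multilinear form with polynomial arguments -/
noncomputable def MM (L : Type*) [Field L] [Algebra K L] (m : ℕ) (G : MvPolynomial σ K) :
    MultilinearMap (MvPolynomial σ L) (fun _ : Fin m => σ → MvPolynomial σ L) (MvPolynomial σ L) :=
  ML m (map (algebraMap K (MvPolynomial σ L)) G) X

def Vt {m : ℕ} (G : MvPolynomial σ K) (ξ : Fin m → σ → L) (B : Finset (Fin m)) (q s : ℕ)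
    (y : MvPolynomial σ L) : Prop :=
  ∃ (w : Fin m → σ → MvPolynomial σ L) (a : Fin m → ℕ),
    (∀ j, a j = 0 → w j = fun i => C (ξ j i)) ∧ (∀ j i, (w j i).totalDegree ≤ a j) ∧
    (∀ j, j ∉ B → a j = 0) ∧ (Finset.univ.filter fun j => a j ≠ 0).card < q ∧
    ∑ j, a j ≤ s ∧ y = MM L m G w

def PR (s : ℕ) (y : MvPolynomial σ L) : Prop :=
  ∃ Q P : MvPolynomial σ L, Q.totalDegree ≤ s ∧ P.totalDegree ≤ s ∧ y = Q * P

def nn (m : ℕ) : ℕ → ℕ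
  | 0 => 0
  | q + 1 => nn m q * m + m

def rr (m g : ℕ) : ℕ → ℕ
  | 0 => 0
  | k + 1 => nn m (k + 1) * rr m g k + m * g

lemma nn_mono (m : ℕ) : Monotone (nn m) := by
  apply monotone_nat_of_le_succ
  intro q
  rcases m with _ | m
  · induction q with
    | zero => simp [nn]
    | succ q ih => simp [nn]
  · simp only [nn]; nlinarith [Nat.zero_le (nn (m+1) q)]

lemma sum_update_le {m : ℕ} (a : Fin m → ℕ) (i : Fin m) (b : ℕ) :
    ∑ j, Function.update a i (a i + b) j = ∑ j, a j + b := by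
  rw [Finset.sum_update_of_mem (Finset.mem_univ i), ← Finset.add_sum_erase _ a (Finset.mem_univ i),
    ← Finset.erase_eq]
  ring

/-- differentiating one term -/
lemma Vt_der {m : ℕ} {G : MvPolynomial σ K} {ξ : Fin m → σ → L} {B : Finset (Fin m)} {q s : ℕ}
    {y : MvPolynomial σ L} (hy : Vt G ξ B q s y) (j : Fin m) (hj : j ∉ B) (b : ℕ) (hb : b ≠ 0)
    (D : Derivation K (MvPolynomial σ L) (MvPolynomial σ L))
    (hD : ∀ f, (D f).totalDegree ≤ f.totalDegree + b) (hX : ∀ i, D (X i) = 0)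
    (hξ : ∀ j', j' ≠ j → ∀ i, D (C (ξ j' i)) = 0) :
    SL (Vt G ξ (insert j B) (q + 1) (s + b)) m (D y) := by
  obtain ⟨w, a, h1, h2, h3, h4, h5, rfl⟩ := hy
  unfold MM
  rw [ML_der D m G X hX w]
  have := SL_sum (P := Vt G ξ (insert j B) (q + 1) (s + b)) (n := 1) Finset.univ
    (fun i => ML m (map (algebraMap K (MvPolynomial σ L)) G) X
      (Function.update w i fun l => D (w i l))) ?_
  · simpa using this
  intro i _
  by_cases hi : a i = 0 ∧ i ≠ j
  · have : (fun l => D (w i l)) = 0 := by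
      funext l; rw [h1 i hi.1]; simp [hξ i hi.2 l]
    rw [this, MultilinearMap.map_update_zero]
    exact SL_zero _ _
  · apply SL_one
    refine ⟨_, Function.update a i (a i + b), ?_, ?_, ?_, ?_, ?_, rfl⟩
    · intro j' hj'
      rcases eq_or_ne j' i with rfl | hne
      · rw [Function.update_self] at hj'; omega
      · rw [Function.update_of_ne hne] at hj' ⊢
        exact h1 j' hj'
    · intro j' l
      rcases eq_or_ne j' i with rfl | hne
      · rw [Function.update_self, Function.update_self]
        exact (hD _).trans (by have := h2 j' l; omega)
      · rw [Function.update_of_ne hne, Function.update_of_ne hne]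
        exact h2 j' l
    · intro j' hj'
      rw [Finset.mem_insert, not_or] at hj'
      have hne : j' ≠ i := by
        rintro rfl
        exact hi ⟨h3 _ hj'.2, hj'.1⟩
      rw [Function.update_of_ne hne]
      exact h3 _ hj'.2
    · have : (Finset.univ.filter fun j' => Function.update a i (a i + b) j' ≠ 0) ⊆
          insert i (Finset.univ.filter fun j' => a j' ≠ 0) := by
        intro j' hj'
        rcases eq_or_ne j' i with rfl | hne
        · simp
        · rw [Finset.mem_filter, Function.update_of_ne hne] at hj'
          simp [hj'.2]
      have := (Finset.card_le_card this).trans (Finset.card_insert_le _ _)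
      omega
    · rw [sum_update_le]; omega

lemma step2 {m : ℕ} {G : MvPolynomial σ K} {ξ : Fin m → σ → L}
    (h0 : MM L m G (fun j i => C (ξ j i)) = 0) (a : Fin m → ℕ)
    (D : Fin m → Derivation K (MvPolynomial σ L) (MvPolynomial σ L)) (B : Finset (Fin m))
    (ha : ∀ j ∈ B, a j ≠ 0)
    (hD : ∀ j ∈ B, ∀ f, (D j f).totalDegree ≤ f.totalDegree + a j)
    (hX : ∀ j ∈ B, ∀ i, D j (X i) = 0)
    (hξ : ∀ j ∈ B, ∀ j', j' ≠ j → ∀ i, D j (C (ξ j' i)) = 0) :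
    SL (Vt G ξ B B.card (∑ j ∈ B, a j)) (nn m B.card)
      (MM L m G (fun j i => if j ∈ B then D j (C (ξ j i)) else C (ξ j i))) := by
  induction B using Finset.induction_on with
  | empty => simpa [h0] using SL_zero _ _
  | insert j B hj ih =>
    have ih := ih (fun j hj => ha j (by simp [hj])) (fun j hj => hD j (by simp [hj]))
      (fun j hj => hX j (by simp [hj])) (fun j hj => hξ j (by simp [hj]))
    set W : Fin m → σ → MvPolynomial σ L :=
      fun j i => if j ∈ B then D j (C (ξ j i)) else C (ξ j i) with hW
    have hjB : j ∈ insert j B := by simp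
    have d1 := ML_der (D j) m G X (hX j hjB) W
    rw [← Finset.add_sum_erase _ _ (Finset.mem_univ j)] at d1
    have hup : (Function.update W j fun i => (D j) (W j i)) =
        fun j' i => if j' ∈ insert j B then D j' (C (ξ j' i)) else C (ξ j' i) := by
      funext j' i
      rcases eq_or_ne j' j with rfl | hne
      · simp [hW, hj]
      · simp [hW, hne]
    rw [hup] at d1
    have d2 : MM L m G
        (fun j' i => if j' ∈ insert j B then D j' (C (ξ j' i)) else C (ξ j' i)) =
        D j (MM L m G W) + ∑ i ∈ Finset.univ.erase j,
          -(MM L m G (Function.update W i fun l => D j (W i l))) := by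
      rw [Finset.sum_neg_distrib]
      unfold MM
      rw [d1]; ring
    rw [d2, Finset.card_insert_of_notMem hj, Finset.sum_insert hj, nn, add_comm (a j)]
    refine SL_add (SL_bind (D j : _ →ₗ[K] _).toAddMonoidHom ih fun z hz =>
      Vt_der hz j hj (a j) (ha j hjB) (D j) (hD j hjB) (hX j hjB) (hξ j hjB)) ?_
    have := SL_sum (P := Vt G ξ (insert j B) (B.card + 1) (∑ j ∈ B, a j + a j)) (n := 1)
      (Finset.univ.erase j)
      (fun i => -(MM L m G (Function.update W i fun l => D j (W i l)))) ?_
    · exact SL_mono this (by simp) fun _ h => h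
    intro i hi
    have hij : i ≠ j := Finset.ne_of_mem_erase hi
    by_cases hiB : i ∈ B
    · apply SL_one
      refine ⟨Function.update W i fun l => - D j (W i l),
        fun j' => if j' ∈ B then (if j' = i then a i + a j else a j') else 0, ?_, ?_, ?_, ?_, ?_, ?_⟩
      · intro j' hj'
        by_cases hB : j' ∈ B
        · have := ha j' (by simp [hB])
          dsimp only at hj'
          rw [if_pos hB] at hj'
          split_ifs at hj' with h
          · subst h; omega
          · omega
        · have hne : j' ≠ i := by rintro rfl; exact hB hiB
          rw [Function.update_of_ne hne]
          funext l; simp [hW, hB]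
      · intro j' l
        rcases eq_or_ne j' i with rfl | hne
        · dsimp only
          rw [Function.update_self, totalDegree_neg, if_pos hiB, if_pos rfl]
          refine (hD j hjB _).trans ?_
          simp only [hW, if_pos hiB]
          have := hD j' (by simp [hiB]) (C (ξ j' l))
          rw [totalDegree_C] at this
          omega
        · dsimp only
          rw [Function.update_of_ne hne, if_neg hne]
          simp only [hW]
          split_ifs with hB
          · have := hD j' (by simp [hB]) (C (ξ j' l))
            rw [totalDegree_C] at this
            omega
          · simp
      · intro j' hj'
        rw [Finset.mem_insert, not_or] at hj'
        simp [hj'.2]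
      · refine Nat.lt_succ_of_le (Finset.card_le_card ?_)
        intro j' hj'
        by_contra hB
        simp [hB] at hj'
      · rw [Finset.sum_ite_mem, Finset.univ_inter, ← Finset.add_sum_erase _ _ hiB,
          ← Finset.add_sum_erase _ a hiB, if_pos rfl]
        have : ∑ x ∈ B.erase i, (if x = i then a i + a j else a x) = ∑ x ∈ B.erase i, a x :=
          Finset.sum_congr rfl fun x hx => by rw [if_neg (Finset.ne_of_mem_erase hx)]
        rw [this]; omega
      · have := (MM L m G).map_update_neg W i (fun l => D j (W i l))
        rw [← this]; rfl
    · have : (fun l => D j (W i l)) = 0 := by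
        funext l; simp [hW, hiB, hξ j hjB i hij l]
      rw [this, MultilinearMap.map_update_zero, neg_zero]
      exact SL_zero _ _

/-- replacing coordinates by tangent vectors -/
lemma step1 {m g : ℕ} {G : MvPolynomial σ K} (a : Fin m → ℕ) (s : ℕ) (hs : ∑ j, a j ≤ s)
    (w t : Fin m → σ → MvPolynomial σ L)
    (hw : ∀ j i, (w j i).totalDegree ≤ a j) (B : Finset (Fin m)) (ha : ∀ j ∈ B, a j ≠ 0)
    (ht : ∀ j ∈ B, ∀ i, (t j i).totalDegree ≤ a j)
    (Λ : Fin m → Fin g → MvPolynomial σ L) (f : Fin m → Fin g → σ → L)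
    (hΛ : ∀ j ∈ B, ∀ b, (Λ j b).totalDegree ≤ a j)
    (h : ∀ j ∈ B, ∀ i, w j i = t j i + ∑ b, Λ j b * C (f j b i)) :
    SL (PR s) (B.card * g) (MM L m G w - MM L m G (fun j => if j ∈ B then t j else w j)) := by
  induction B using Finset.induction_on with
  | empty => simpa using SL_zero _ _
  | insert j B hj ih =>
    have ih := ih (fun j hj => ha j (by simp [hj])) (fun j hj => ht j (by simp [hj]))
      (fun j hj => hΛ j (by simp [hj])) (fun j hj => h j (by simp [hj]))
    have hjB : j ∈ insert j B := by simp
    set W : Fin m → σ → MvPolynomial σ L := fun j => if j ∈ B then t j else w j with hW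
    have hWd : ∀ j' i, (W j' i).totalDegree ≤ a j' := by
      intro j' i; simp only [hW]
      split_ifs with hB
      · exact ht j' (by simp [hB]) i
      · exact hw j' i
    have e1 : (fun j' => if j' ∈ insert j B then t j' else w j') = Function.update W j (t j) := by
      funext j'
      rcases eq_or_ne j' j with rfl | hne
      · simp
      · simp [hW, hne]
    have e2 : W = Function.update W j (t j + ∑ b, Λ j b • fun i => C (f j b i)) := by
      have : t j + ∑ b, Λ j b • (fun i => C (f j b i)) = W j := by
        funext i
        simp only [hW, if_neg hj]
        rw [h j hjB i]; simp
      rw [this]; simp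
    have e3 : MM L m G W = MM L m G (Function.update W j (t j)) +
        ∑ b, Λ j b * MM L m G (Function.update W j fun i => C (f j b i)) := by
      conv_lhs => rw [e2]
      rw [MultilinearMap.map_update_add, MultilinearMap.map_update_sum]
      congr 1
      refine Finset.sum_congr rfl fun b _ => ?_
      rw [MultilinearMap.map_update_smul]; rfl
    rw [e1, Finset.card_insert_of_notMem hj, add_mul, one_mul]
    have e4 : MM L m G w - MM L m G (Function.update W j (t j)) = (MM L m G w - MM L m G W) +
        ∑ b, Λ j b * MM L m G (Function.update W j fun i => C (f j b i)) := by
      rw [e3]; ring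
    rw [e4]
    refine SL_add ih ?_
    have := SL_sum (P := PR s) (n := 1) Finset.univ
      (fun b => Λ j b * MM L m G (Function.update W j fun i => C (f j b i))) ?_
    · simpa using this
    intro b _
    apply SL_one
    have hsum : ∑ j', Function.update a j 0 j' + a j = ∑ j', a j' := by
      rw [Finset.sum_update_of_mem (Finset.mem_univ j),
        ← Finset.add_sum_erase _ a (Finset.mem_univ j), ← Finset.erase_eq]
      ring
    have haj := ha j hjB
    refine ⟨_, _, ?_, ?_, rfl⟩
    · exact (hΛ j hjB b).trans ((Finset.single_le_sum (f := a) (fun _ _ => Nat.zero_le _)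
        (Finset.mem_univ j)).trans hs)
    · refine (ML_deg m G _ (Function.update a j 0) ?_).trans (by omega)
      intro j' i
      rcases eq_or_ne j' j with rfl | hne
      · simp
      · rw [Function.update_of_ne hne, Function.update_of_ne hne]
        exact hWd j' i

theorem claim {m g : ℕ} {G : MvPolynomial σ K} {ξ : Fin m → σ → L}
    (h0 : MM L m G (fun j i => C (ξ j i)) = 0) (hT : Tan K ξ g) (k : ℕ) (s : ℕ)
    (y : MvPolynomial σ L) (hy : Vt G ξ Finset.univ (k + 1) s y) : SL (PR s) (rr m g k) y := by
  classical
  induction k generalizing y with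
  | zero =>
    obtain ⟨w, a, h1, h2, h3, h4, h5, rfl⟩ := hy
    have : ∀ j, a j = 0 := by
      simpa [Finset.filter_eq_empty_iff] using h4
    have : w = fun j i => C (ξ j i) := funext fun j => h1 j (this j)
    rw [this, h0]
    exact SL_zero _ _
  | succ k ih =>
    obtain ⟨w, a, h1, h2, h3, h4, h5, rfl⟩ := hy
    choose D hD hX hξ Λ f hΛ hw using fun j => TanR hT j (w j) (a j) (h2 j)
    set B := Finset.univ.filter fun j => a j ≠ 0 with hB
    have hBa : ∀ j ∈ B, a j ≠ 0 := fun j hj => (Finset.mem_filter.1 hj).2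
    have s2 := step2 h0 a D B hBa (fun j _ => hD j) (fun j _ => hX j) (fun j _ => hξ j)
    have s1 := step1 (G := G) a s h5 w (fun j i => D j (C (ξ j i))) h2 B hBa
      (fun j _ i => (hD j _).trans (by rw [totalDegree_C]; omega)) Λ f (fun j _ => hΛ j)
      (fun j _ => hw j)
    have e : (fun j => if j ∈ B then (fun i => D j (C (ξ j i))) else w j) =
        (fun j i => if j ∈ B then D j (C (ξ j i)) else C (ξ j i)) := by
      funext j
      by_cases hj : j ∈ B
      · simp [hj]
      · simp only [if_neg hj]
        apply h1
        by_contra hc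
        exact hj (by simp [hB, hc])
    rw [e] at s1
    have s3 := SL_bind (AddMonoidHom.id _) s2 (fun z hz => ih z ?_) (P' := PR s) (n' := rr m g k)
    · have := SL_add s3 s1
      rw [AddMonoidHom.id_apply, add_sub_cancel] at this
      refine SL_mono this ?_ fun _ h => h
      rw [rr]
      have c1 : B.card ≤ k + 1 := by omega
      have c2 : B.card ≤ m := by simpa using Finset.card_le_univ B
      have := nn_mono m c1
      gcongr
    · obtain ⟨w', a', g1, g2, g3, g4, g5, rfl⟩ := hz
      refine ⟨w', a', g1, g2, by simp, by omega, g5.trans (le_trans ?_ h5), rfl⟩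
      exact Finset.sum_le_sum_of_subset (Finset.subset_univ B)

theorem schmidt {m g : ℕ} {G : MvPolynomial σ K} (hG : G.IsHomogeneous (m+1))
    (hchar : ((m+1).factorial : L) ≠ 0) {ξ : Fin m → σ → L}
    (h0 : MM L m G (fun j i => C (ξ j i)) = 0) (hT : Tan K ξ g) :
    SL (PR m) (rr m g m) (map (algebraMap K L) G) := by
  have h := claim h0 hT m m (MM L m G (fun _ => X))
    ⟨fun _ => X, fun _ => 1, by simp, by simp, by simp, by simp, by simp, rfl⟩
  unfold MM at h
  rw [ML_euler m _ (hG.map _)] at h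
  have e : eval X (map (algebraMap K (MvPolynomial σ L)) G) = map (algebraMap K L) G := by
    rw [eval_map, IsScalarTower.algebraMap_eq K L (MvPolynomial σ L), algebraMap_eq]
    have e' : eval₂Hom (C.comp (algebraMap K L)) (X : σ → MvPolynomial σ L) =
        map (algebraMap K L) := by
      apply MvPolynomial.ringHom_ext <;> simp
    exact congrArg (fun f => f G) e'
  rw [e] at h
  have h2 := SL_bind (AddMonoidHom.mulLeft (C (((m+1).factorial : L)⁻¹))) (P' := PR m) (n' := 1) h ?_
  · rw [AddMonoidHom.coe_mulLeft, ← map_natCast (C : L →+* MvPolynomial σ L), ← mul_assoc, ← C_mul,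
      inv_mul_cancel₀ hchar, C_1, one_mul, mul_one] at h2
    exact h2
  · rintro z ⟨Q, P, hQ, hP, rfl⟩
    apply SL_one
    refine ⟨C (((m+1).factorial : L)⁻¹) * Q, P, ?_, hP, by simp [mul_assoc]⟩
    refine (totalDegree_mul _ _).trans ?_
    rw [totalDegree_C]; omega
end schmidt


section kae
variable {K L ι : Type*} [Field L] [Field K] [Algebra K L]

open scoped IntermediateField.algebraAdjoinAdjoin in
lemma kaehler_finrank_aux [Fintype ι] {v : ι → L} (hb : AlgebraicIndependent K v)
    [Algebra.IsSeparable (IntermediateField.adjoin K (Set.range v)) L] :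
    Module.Finite L Ω[L⁄K] ∧ Module.finrank L Ω[L⁄K] = Fintype.card ι := by
  have e1 : Algebra.FormallyEtale (Algebra.adjoin K (Set.range v))
      (IntermediateField.adjoin K (Set.range v)) :=
    .of_isLocalization (nonZeroDivisors _)
  have e2 : Algebra.FormallyEtale (IntermediateField.adjoin K (Set.range v)) L :=
    Algebra.FormallyEtale.of_isSeparable _ L
  have e3 : Algebra.FormallyEtale (Algebra.adjoin K (Set.range v)) L :=
    .comp _ (IntermediateField.adjoin K (Set.range v)) _
  letI : Algebra (MvPolynomial ι K) (Algebra.adjoin K (Set.range v)) :=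
    (hb.aevalEquiv : _ →+* _).toAlgebra
  letI : Algebra (MvPolynomial ι K) L := (aeval v : MvPolynomial ι K →ₐ[K] L).toRingHom.toAlgebra
  have t1 : IsScalarTower (MvPolynomial ι K) (Algebra.adjoin K (Set.range v)) L :=
    IsScalarTower.of_algebraMap_eq fun x => (hb.algebraMap_aevalEquiv x).symm
  have t2 : IsScalarTower K (MvPolynomial ι K) L :=
    IsScalarTower.of_algebraMap_eq fun x => (by
      change _ = aeval v (algebraMap K _ x)
      simp)
  have e4 : Algebra.FormallyEtale (MvPolynomial ι K) (Algebra.adjoin K (Set.range v)) :=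
    Algebra.FormallyEtale.of_equiv (R := MvPolynomial ι K) (A := MvPolynomial ι K)
      (AlgEquiv.ofBijective (Algebra.ofId _ _) hb.aevalEquiv.bijective)
  have e5 : Algebra.FormallyEtale (MvPolynomial ι K) L :=
    .comp _ (Algebra.adjoin K (Set.range v)) _
  have bb := (KaehlerDifferential.mvPolynomialBasis K ι).baseChange L
  have bb2 := bb.map (KaehlerDifferential.tensorKaehlerEquivOfFormallyEtale K (MvPolynomial ι K) L)
  exact ⟨Module.Finite.of_basis bb2, Module.finrank_eq_card_basis bb2⟩

lemma kaehler_finrank [PerfectField K] [Algebra.EssFiniteType K L] :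
    Module.Finite L Ω[L⁄K] ∧ (Module.finrank L Ω[L⁄K] : Cardinal) = Algebra.trdeg K L := by
  obtain ⟨s, hs, H⟩ := exists_isTranscendenceBasis_and_isSeparable_of_perfectField K L
  have : Algebra.IsSeparable (↥(IntermediateField.adjoin K (Set.range ((↑) : s → L)))) L := by
    convert! H <;> simp
  have := kaehler_finrank_aux (ι := s) hs.1
  refine ⟨this.1, ?_⟩
  rw [this.2, ← hs.cardinalMk_eq_trdeg]
  simp

end kae


section tang
variable {K L σ : Type*} [Field L] [Field K] [Algebra K L] [Fintype σ] [DecidableEq σ]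

lemma span_fin {V : Type*} [AddCommGroup V] [Module L V] [Module.Finite L V] {g : ℕ}
    (h : Module.finrank L V ≤ g) : ∃ v : Fin g → V, Submodule.span L (Set.range v) = ⊤ := by
  let b := Module.finBasis L V
  refine ⟨fun a => if h : (a : ℕ) < Module.finrank L V then b ⟨a, h⟩ else 0, ?_⟩
  rw [eq_top_iff, ← b.span_eq]
  apply Submodule.span_mono
  rintro _ ⟨i, rfl⟩
  exact ⟨⟨i, i.2.trans_le h⟩, by simp⟩

lemma finrank_der [PerfectField K] [Algebra.EssFiniteType K L] :
    (Module.finrank L (Derivation K L L) : Cardinal) = Algebra.trdeg K L := by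
  obtain ⟨h1, h2⟩ := kaehler_finrank (K := K) (L := L)
  rw [← h2, ← (KaehlerDifferential.linearMapEquivDerivation K L (M := L)).finrank_eq]
  rw [Module.finrank_linearMap, Module.finrank_self, mul_one]

lemma tan_of_trdeg [PerfectField K] [Algebra.EssFiniteType K L] {m g : ℕ} (ξ : Fin m → σ → L)
    (hgen : ∀ l : L, ∃ a ∈ Algebra.adjoin K (Set.range fun t : Fin m × σ => ξ t.1 t.2),
      ∃ b ∈ Algebra.adjoin K (Set.range fun t : Fin m × σ => ξ t.1 t.2), b ≠ 0 ∧ b * l = a)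
    (hg : (Fintype.card (Fin m × σ) : Cardinal) ≤ Algebra.trdeg K L + g) : Tan K ξ g := by
  let Φ : Derivation K L L →ₗ[L] (Fin m × σ → L) :=
    { toFun := fun δ t => δ (ξ t.1 t.2)
      map_add' := fun _ _ => rfl
      map_smul' := fun _ _ => rfl }
  have hinj : Function.Injective Φ := by
    rw [injective_iff_map_eq_zero]
    intro δ hδ
    have h0 : Set.EqOn δ (0 : Derivation K L L)
        (Algebra.adjoin K (Set.range fun t : Fin m × σ => ξ t.1 t.2)) := by
      apply Derivation.eqOn_adjoin
      rintro _ ⟨t, rfl⟩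
      exact congrFun hδ t
    ext l
    obtain ⟨a, ha, b, hb, hb0, hl⟩ := hgen l
    have h1 := h0 ha
    have h2 := h0 hb
    rw [← hl, Derivation.leibniz, h2] at h1
    simpa [hb0] using h1
  have hr : Module.finrank L (LinearMap.range Φ) = Module.finrank L (Derivation K L L) :=
    LinearMap.finrank_range_of_inj hinj
  rw [← finrank_der, ← hr] at hg
  have hg' : Fintype.card (Fin m × σ) ≤ Module.finrank L (LinearMap.range Φ) + g := by
    exact_mod_cast hg
  intro j
  let inj : (σ → L) →ₗ[L] (Fin m × σ → L) :=
    { toFun := fun u t => if t.1 = j then u t.2 else 0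
      map_add' := by intro u v; funext t; simp only [Pi.add_apply]; split_ifs <;> simp
      map_smul' := by intro u v; funext t; simp }
  let T := (LinearMap.range Φ).comap inj
  have hq : Module.finrank L ((σ → L) ⧸ T) ≤ g := by
    have h1 : Module.finrank L ((σ → L) ⧸ T) ≤
        Module.finrank L ((Fin m × σ → L) ⧸ LinearMap.range Φ) := by
      apply LinearMap.finrank_le_finrank_of_injective
        (f := Submodule.mapQ T (LinearMap.range Φ) inj le_rfl)
      rw [← LinearMap.ker_eq_bot, Submodule.ker_mapQ]
      simp [T]
    have h2 := Submodule.finrank_quotient_add_finrank (LinearMap.range Φ)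
    rw [Module.finrank_fintype_fun_eq_card] at h2
    omega
  obtain ⟨v, hv⟩ := span_fin hq
  choose f hf using fun a => Submodule.Quotient.mk_surjective T (v a)
  have hk : ∀ k : σ, ∃ lam : Fin g → L,
      ∑ a, lam a • v a = Submodule.Quotient.mk (p := T) (Pi.single k (1 : L)) := by
    intro k
    rw [← Submodule.mem_span_range_iff_exists_fun, hv]
    trivial
  choose lam hlam using hk
  have hδ : ∀ k, ∃ δ : Derivation K L L,
      Φ δ = inj (Pi.single k (1 : L) - ∑ a, lam k a • f a) := by
    intro k
    have : Pi.single k (1 : L) - ∑ a, lam k a • f a ∈ T := by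
      rw [← Submodule.Quotient.eq, ← hlam, ← Submodule.mkQ_apply, map_sum]
      simp [hf]
    exact this
  choose δ hδ using hδ
  refine ⟨δ, fun a k => lam k a, f, ?_, ?_⟩
  · intro k j' hj' i
    have := congrFun (hδ k) (j', i)
    simpa [Φ, inj, hj'] using this
  · intro k i
    have := congrFun (hδ k) (j, i)
    simp only [Φ, inj, LinearMap.coe_mk, AddHom.coe_mk, if_true, Pi.sub_apply, Finset.sum_apply,
      Pi.smul_apply, smul_eq_mul, Pi.single_apply] at this
    rw [this]; ring
end tang


section spec
variable {K L σ : Type*} [Field K] [IsAlgClosed K] [Field L] [Algebra K L]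

lemma exists_spec (S : Finset L) : Nonempty (Algebra.adjoin K (S : Set L) →ₐ[K] K) := by
  obtain ⟨M, hM⟩ := Ideal.exists_maximal (Algebra.adjoin K (S : Set L))
  have ft : Algebra.FiniteType K (Algebra.adjoin K (S : Set L)) :=
    (Subalgebra.fg_iff_finiteType _).1 ⟨S, rfl⟩
  let _ := Ideal.Quotient.field M
  have ft2 : Algebra.FiniteType K (Algebra.adjoin K (S : Set L) ⧸ M) :=
    ft.of_surjective (Ideal.Quotient.mkₐ K M) (Ideal.Quotient.mkₐ_surjective K M)
  have := finite_of_finite_type_of_isJacobsonRing K (Algebra.adjoin K (S : Set L) ⧸ M)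
  have tf : Module.IsTorsionFree K (Algebra.adjoin K (S : Set L) ⧸ M) :=
    (Module.Free.of_divisionRing K _).instIsTorsionFree
  exact ⟨(IsAlgClosed.lift (R := K) (S := Algebra.adjoin K (S : Set L) ⧸ M) (M := K)).comp
    (Ideal.Quotient.mkₐ K M)⟩

lemma homRank_le {m r : ℕ} {G : MvPolynomial σ K}
    (h : SL (PR (σ := σ) m) r (map (algebraMap K L) G)) : homRank (m+1) G ≤ r := by
  classical
  obtain ⟨l, hl, h1, h2⟩ := h
  refine le_trans ?_ hl
  choose! Q P hQ hP hQP using h1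
  let S : Finset L := (Finset.univ : Finset (Fin l.length)).biUnion fun i =>
    (Q (l.get i)).coeffs ∪ (P (l.get i)).coeffs
  obtain ⟨φ⟩ := exists_spec (K := K) S
  let B := Algebra.adjoin K (S : Set L)
  let v : B →+* L := B.val.toRingHom
  have vinj : Function.Injective v := Subtype.val_injective
  have hS : ∀ f : MvPolynomial σ L, f.coeffs ⊆ S → ∃ f' : MvPolynomial σ B, map v f' = f := by
    intro f hf
    have : f ∈ Set.range (map (σ := σ) v) := by
      rw [mem_range_map_iff_coeffs_subset]
      intro x hx
      exact ⟨⟨x, Algebra.subset_adjoin (hf hx)⟩, rfl⟩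
    exact this
  have hdeg : ∀ f : MvPolynomial σ B, (map φ.toRingHom f).totalDegree ≤ (map v f).totalDegree := by
    intro f
    unfold totalDegree
    rw [support_map_of_injective f vinj]
    exact Finset.sup_mono (support_map_subset _ _)
  choose Q' hQ' using fun i : Fin l.length => hS (Q (l.get i)) (fun x hx => Finset.mem_biUnion.2
    ⟨i, Finset.mem_univ _, Finset.mem_union_left _ hx⟩)
  choose P' hP' using fun i : Fin l.length => hS (P (l.get i)) (fun x hx => Finset.mem_biUnion.2
    ⟨i, Finset.mem_univ _, Finset.mem_union_right _ hx⟩)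
  apply Nat.sInf_le
  refine ⟨fun i => map φ.toRingHom (Q' i), fun i => map φ.toRingHom (P' i), fun i => ⟨?_, ?_⟩, ?_⟩
  · have := hdeg (Q' i)
    rw [hQ'] at this
    have := hQ _ (List.get_mem l i)
    dsimp only
    omega
  · have := hdeg (P' i)
    rw [hP'] at this
    have := hP _ (List.get_mem l i)
    dsimp only
    omega
  · have key : map (algebraMap K B) G = ∑ i, Q' i * P' i := by
      apply map_injective v vinj
      rw [map_map, map_sum]
      simp only [map_mul, hQ', hP']
      have e : v.comp (algebraMap K B) = algebraMap K L := rfl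
      rw [e, ← h2, ← Fin.sum_univ_getElem l]
      exact Finset.sum_congr rfl fun i _ => hQP _ (List.get_mem l i)
    have := congrArg (map φ.toRingHom) key
    rw [map_map, map_sum] at this
    have e : φ.toRingHom.comp (algebraMap K B) = RingHom.id K := by
      ext x; exact φ.commutes x
    rw [e, map_id] at this
    simpa [map_mul] using this
end spec


section cnt
universe u
variable {τ : Type} [Fintype τ] [DecidableEq τ] {K : Type u} [Field K]

open Classical in
noncomputable def VF (I : Ideal (MvPolynomial τ K)) (A : Finset K) : Finset (τ → K) :=
  (Fintype.piFinset fun _ : τ => A).filter fun y => ∀ f ∈ I, eval y f = 0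

lemma mem_VF {I : Ideal (MvPolynomial τ K)} {A : Finset K} {y : τ → K} :
    y ∈ VF I A ↔ (∀ i, y i ∈ A) ∧ ∀ f ∈ I, eval y f = 0 := by
  simp [VF]

lemma VF_sup_span {I : Ideal (MvPolynomial τ K)} {A : Finset K} {y : τ → K}
    (hy : y ∈ VF I A) {h : MvPolynomial τ K} (hh : eval y h = 0) : y ∈ VF (I ⊔ Ideal.span {h}) A := by
  rw [mem_VF] at hy ⊢
  refine ⟨hy.1, ?_⟩
  have : I ⊔ Ideal.span {h} ≤ RingHom.ker (eval y) := by
    refine sup_le (fun f hf => hy.2 f hf) ?_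
    rw [Ideal.span_singleton_le_iff_mem]
    exact hh
  exact fun f hf => this hf

/-- data for the prime case -/
lemma prime_data (P : Ideal (MvPolynomial τ K)) [P.IsPrime] :
    ∃ (ι : Type u) (_ : Fintype ι) (e : ι → τ) (q : τ → Polynomial (MvPolynomial ι K)),
      (Fintype.card ι : Cardinal) ≤ Algebra.trdeg K (FractionRing (MvPolynomial τ K ⧸ P)) ∧
      (∀ i, rename e (q i).leadingCoeff ∉ P) ∧
      ∀ i, (q i).eval₂ (rename e : MvPolynomial ι K →ₐ[K] MvPolynomial τ K).toRingHom (X i) ∈ P := by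
  let R := MvPolynomial τ K ⧸ P
  let ξ : τ → R := fun i => Ideal.Quotient.mk P (X i)
  have hadj : Algebra.adjoin K (Set.range ξ) = ⊤ := by
    have h1 : Set.range ξ = (Ideal.Quotient.mkₐ K P) '' (Set.range X) := by
      rw [← Set.range_comp]; rfl
    rw [h1, ← AlgHom.map_adjoin, adjoin_range_X, Algebra.map_top, AlgHom.range_eq_top]
    exact Ideal.Quotient.mkₐ_surjective K P
  have halg : Algebra.IsAlgebraic (Algebra.adjoin K (Set.range ξ)) R := by
    constructor
    intro x
    have hx : x ∈ Algebra.adjoin K (Set.range ξ) := by rw [hadj]; trivial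
    exact isAlgebraic_algebraMap (⟨x, hx⟩ : Algebra.adjoin K (Set.range ξ))
  obtain ⟨t, ht, hb⟩ := exists_isTranscendenceBasis_subset (R := K) (Set.range ξ)
  have tf : t.Finite := (Set.finite_range ξ).subset ht
  let _ := tf.fintype
  choose e he using fun x : t => ht x.2
  have hcomp : ((Ideal.Quotient.mkₐ K P).comp (rename e)) =
      (aeval ((↑) : t → R) : MvPolynomial t K →ₐ[K] R) := by
    ext x; simp [← he]; rfl
  have hq : ∀ i, ∃ q : Polynomial (MvPolynomial t K), q ≠ 0 ∧
      q.eval₂ (aeval ((↑) : t → R) : MvPolynomial t K →ₐ[K] R).toRingHom (ξ i) = 0 := by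
    intro i
    obtain ⟨p, hp, hp0⟩ := hb.isAlgebraic.isAlgebraic (ξ i)
    refine ⟨p.map (hb.1.aevalEquiv.symm : _ →+* _), ?_, ?_⟩
    · rwa [Ne, Polynomial.map_eq_zero_iff]
      exact hb.1.aevalEquiv.symm.injective
    · rw [Polynomial.eval₂_map, ← hp0, Polynomial.aeval_def]
      congr 1
      ext x
      have := hb.1.algebraMap_aevalEquiv (hb.1.aevalEquiv.symm x)
      rw [AlgEquiv.apply_symm_apply] at this
      exact this.symm
  choose q hq0 hq1 using hq
  refine ⟨t, inferInstance, e, q, ?_, ?_, ?_⟩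
  · have : AlgebraicIndependent K (fun x : t => algebraMap R (FractionRing R) x) :=
      hb.1.map' (f := IsScalarTower.toAlgHom K R (FractionRing R))
        (IsFractionRing.injective R (FractionRing R))
    simpa using this.cardinalMk_le_trdeg
  · intro i hi
    have h1 : aeval ((↑) : t → R) (q i).leadingCoeff = 0 := by
      rw [← hcomp, AlgHom.comp_apply]
      exact Ideal.Quotient.eq_zero_iff_mem.2 hi
    have := (injective_iff_map_eq_zero _).1 hb.1 _ h1
    exact hq0 i (Polynomial.leadingCoeff_eq_zero.1 this)
  · intro i
    rw [← Ideal.Quotient.eq_zero_iff_mem, Polynomial.hom_eval₂, ← hq1 i, ← hcomp]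
    rfl

lemma prime_count {ι : Type*} [Fintype ι] (P : Ideal (MvPolynomial τ K)) (e : ι → τ)
    (q : τ → Polynomial (MvPolynomial ι K))
    (h1 : ∀ i, (q i).eval₂ (rename e : MvPolynomial ι K →ₐ[K] MvPolynomial τ K).toRingHom (X i) ∈ P)
    (A : Finset K) :
    (VF P A).card ≤ ∑ i, (VF (P ⊔ Ideal.span {rename e (q i).leadingCoeff}) A).card +
      (∏ i, (q i).natDegree) * A.card ^ Fintype.card ι := by
  classical
  let B := (VF P A).filter fun y => ∀ i, eval y (rename e (q i).leadingCoeff) ≠ 0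
  have hsub : VF P A ⊆ (Finset.univ.biUnion fun i =>
      VF (P ⊔ Ideal.span {rename e (q i).leadingCoeff}) A) ∪ B := by
    intro y hy
    rw [Finset.mem_union]
    by_cases h : ∀ i, eval y (rename e (q i).leadingCoeff) ≠ 0
    · exact Or.inr (Finset.mem_filter.2 ⟨hy, h⟩)
    · push Not at h
      obtain ⟨i, hi⟩ := h
      exact Or.inl (Finset.mem_biUnion.2 ⟨i, Finset.mem_univ _, VF_sup_span hy hi⟩)
  refine (Finset.card_le_card hsub).trans ((Finset.card_union_le _ _).trans ?_)
  refine Nat.add_le_add Finset.card_biUnion_le ?_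
  have := Finset.card_le_mul_card_image_of_maps_to (s := B)
    (t := Fintype.piFinset fun _ : ι => A) (f := fun y => y ∘ e) ?_ (∏ i, (q i).natDegree) ?_
  · simpa using this
  · intro y hy
    rw [Fintype.mem_piFinset]
    exact fun i => (mem_VF.1 (Finset.mem_filter.1 hy).1).1 _
  · intro z _
    by_cases hz : ∀ i, eval z (q i).leadingCoeff ≠ 0
    · refine le_trans (b := (Fintype.piFinset fun i =>
        ((q i).map (eval z)).roots.toFinset).card) (Finset.card_le_card ?_) ?_
      · intro y hy
        obtain ⟨hyB, rfl⟩ := Finset.mem_filter.1 hy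
        have hyV := mem_VF.1 (Finset.mem_filter.1 hyB).1
        rw [Fintype.mem_piFinset]
        intro i
        rw [Multiset.mem_toFinset, Polynomial.mem_roots']
        constructor
        · intro h0
          apply hz i
          have := congrArg (fun f => Polynomial.coeff f (q i).natDegree) h0
          simpa using this
        · have := hyV.2 _ (h1 i)
          rw [Polynomial.hom_eval₂] at this
          rw [Polynomial.IsRoot.def, Polynomial.eval_map, ← this]
          congr 1
          · apply MvPolynomial.ringHom_ext <;> simp
          · simp
      · rw [Fintype.card_piFinset]
        refine Finset.prod_le_prod' fun i _ => ?_
        exact (Multiset.toFinset_card_le _).trans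
          ((Polynomial.card_roots' _).trans Polynomial.natDegree_map_le)
    · rw [Finset.card_eq_zero.2]; · exact Nat.zero_le _
      rw [Finset.eq_empty_iff_forall_notMem]
      intro y hy
      obtain ⟨hyB, rfl⟩ := Finset.mem_filter.1 hy
      apply hz
      intro i
      have := (Finset.mem_filter.1 hyB).2 i
      rwa [eval_rename] at this

lemma count_bound (g : ℕ) (I : Ideal (MvPolynomial τ K))
    (H : ∀ P : Ideal (MvPolynomial τ K), [P.IsPrime] → I ≤ P →
      ¬ (Fintype.card τ : Cardinal) ≤ Algebra.trdeg K (FractionRing (MvPolynomial τ K ⧸ P)) + g) :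
    ∃ c : ℕ, ∀ A : Finset K, A.Nonempty →
      (VF I A).card * A.card ^ g ≤ c * A.card ^ Fintype.card τ := by
  classical
  induction I using WellFoundedGT.induction with
  | ind I ih =>
  have ih' : ∀ h ∉ I, ∃ c : ℕ, ∀ A : Finset K, A.Nonempty →
      (VF (I ⊔ Ideal.span {h}) A).card * A.card ^ g ≤ c * A.card ^ Fintype.card τ := by
    intro h hh
    apply ih
    · refine lt_of_le_of_ne le_sup_left fun he => hh ?_
      rw [he]
      exact (le_sup_right : Ideal.span {h} ≤ _) (Ideal.mem_span_singleton_self h)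
    · intro P hP hle
      exact H P (le_sup_left.trans hle)
  by_cases htop : I = ⊤
  · refine ⟨0, fun A _ => ?_⟩
    have : VF I A = ∅ := by
      rw [Finset.eq_empty_iff_forall_notMem]
      intro y hy
      have := (mem_VF.1 hy).2 1 (by rw [htop]; trivial)
      simp at this
    simp [this]
  by_cases hprime : I.IsPrime
  · obtain ⟨ι, _, e, q, hc, hl, hq⟩ := prime_data I
    choose c hcc using fun i => ih' _ (hl i)
    have hlt : Fintype.card ι + g ≤ Fintype.card τ := by
      by_contra hcon
      apply H I le_rfl
      calc (Fintype.card τ : Cardinal) ≤ ((Fintype.card ι + g : ℕ) : Cardinal) := by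
            exact_mod_cast (not_le.1 hcon).le
        _ = Fintype.card ι + g := by push_cast; rfl
        _ ≤ _ := by gcongr
    refine ⟨∑ i, c i + ∏ i, (q i).natDegree, fun A hA => ?_⟩
    have hpos : 0 < A.card := hA.card_pos
    calc (VF I A).card * A.card ^ g ≤ (∑ i, (VF (I ⊔ Ideal.span {rename e (q i).leadingCoeff}) A).card +
          (∏ i, (q i).natDegree) * A.card ^ Fintype.card ι) * A.card ^ g := by
            gcongr
            exact prime_count I e q hq A
      _ = ∑ i, (VF (I ⊔ Ideal.span {rename e (q i).leadingCoeff}) A).card * A.card ^ g +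
          (∏ i, (q i).natDegree) * A.card ^ (Fintype.card ι + g) := by
            rw [add_mul, Finset.sum_mul, pow_add, mul_assoc]
      _ ≤ ∑ i, c i * A.card ^ Fintype.card τ + (∏ i, (q i).natDegree) * A.card ^ Fintype.card τ := by
            exact Nat.add_le_add (Finset.sum_le_sum fun i _ => hcc i A hA)
              (Nat.mul_le_mul_left _ (Nat.pow_le_pow_right hpos hlt))
      _ = _ := by rw [add_mul, Finset.sum_mul]
  · rw [Ideal.isPrime_iff] at hprime
    push Not at hprime
    obtain ⟨a, b, hab, ha, hb⟩ := hprime htop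
    obtain ⟨c1, h1⟩ := ih' a ha
    obtain ⟨c2, h2⟩ := ih' b hb
    refine ⟨c1 + c2, fun A hA => ?_⟩
    have hsub : VF I A ⊆ VF (I ⊔ Ideal.span {a}) A ∪ VF (I ⊔ Ideal.span {b}) A := by
      intro y hy
      have := (mem_VF.1 hy).2 _ hab
      rw [map_mul, mul_eq_zero] at this
      rw [Finset.mem_union]
      exact this.imp (VF_sup_span hy) (VF_sup_span hy)
    have := (Finset.card_le_card hsub).trans (Finset.card_union_le _ _)
    calc (VF I A).card * A.card ^ g ≤ ((VF (I ⊔ Ideal.span {a}) A).card +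
          (VF (I ⊔ Ideal.span {b}) A).card) * A.card ^ g := by gcongr
      _ ≤ _ := by rw [add_mul, add_mul]; exact Nat.add_le_add (h1 A hA) (h2 A hA)
end cnt


section geo
universe u
variable {K : Type u} [Field K] {N : ℕ}

noncomputable def pl (m : ℕ) (G : MvPolynomial (Fin N) K) (l : Fin N) :
    MvPolynomial (Fin m × Fin N) K :=
  ML m (map (C : K →+* MvPolynomial (Fin m × Fin N) K) G) (Pi.single l 1) (fun j i => X (j, i))

lemma pl_hom (m : ℕ) (G : MvPolynomial (Fin N) K) (l : Fin N) {S : Type*} [CommRing S]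
    (φ : MvPolynomial (Fin m × Fin N) K →+* S) :
    φ (pl m G l) = ML m (map (φ.comp C) G) (Pi.single l 1) (fun j i => φ (X (j, i))) := by
  unfold pl
  rw [← ML_map, map_map]
  congr 2
  funext i
  rcases eq_or_ne i l with rfl | h
  · simp
  · simp [h]

lemma geo_case [IsAlgClosed K] {m g : ℕ} {G : MvPolynomial (Fin N) K} (hG : G.IsHomogeneous (m+1))
    (hchar : ((m+1).factorial : K) ≠ 0) (P : Ideal (MvPolynomial (Fin m × Fin N) K)) [P.IsPrime]
    (hP : ∀ l, pl m G l ∈ P)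
    (hc : (Fintype.card (Fin m × Fin N) : Cardinal) ≤
      Algebra.trdeg K (FractionRing (MvPolynomial (Fin m × Fin N) K ⧸ P)) + g) :
    homRank (m+1) G ≤ rr m g m := by
  let R := MvPolynomial (Fin m × Fin N) K ⧸ P
  let L := FractionRing R
  let ξ : Fin m → Fin N → L := fun j i => algebraMap R L (Ideal.Quotient.mk P (X (j, i)))
  have f1 : Algebra.EssFiniteType K R := inferInstance
  have f2 : Algebra.EssFiniteType R L := .of_isLocalization _ (nonZeroDivisors R)
  have f3 : Algebra.EssFiniteType K L := .comp K R L
  have hT : Tan K ξ g := by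
    apply tan_of_trdeg ξ _ hc
    have hmem : ∀ r : R, algebraMap R L r ∈
        Algebra.adjoin K (Set.range fun t : Fin m × Fin N => ξ t.1 t.2) := by
      intro r
      obtain ⟨f, rfl⟩ := Ideal.Quotient.mk_surjective r
      have h1 : Set.range (fun t : Fin m × Fin N => ξ t.1 t.2) =
          ((IsScalarTower.toAlgHom K R L).comp (Ideal.Quotient.mkₐ K P)) '' (Set.range X) := by
        rw [← Set.range_comp]; rfl
      rw [h1, ← AlgHom.map_adjoin, adjoin_range_X, Algebra.map_top]
      exact ⟨f, rfl⟩
    intro l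
    obtain ⟨a, b, hb, rfl⟩ := IsFractionRing.div_surjective (A := R) l
    have hb' : algebraMap R L b ≠ 0 := by
      simpa using nonZeroDivisors.ne_zero hb
    exact ⟨_, hmem a, _, hmem b, hb', mul_div_cancel₀ _ hb'⟩
  refine homRank_le (schmidt hG ?_ ?_ hT)
  · rw [← map_natCast (algebraMap K L)]
    exact (map_ne_zero (algebraMap K L)).2 hchar
  · unfold MM
    rw [ML_x]
    refine Finset.sum_eq_zero fun l _ => ?_
    have := pl_hom m G l (((C : L →+* MvPolynomial (Fin N) L).comp (algebraMap R L)).comp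
      (Ideal.Quotient.mk P))
    have h0 : ((C : L →+* MvPolynomial (Fin N) L).comp (algebraMap R L)).comp
      (Ideal.Quotient.mk P) (pl m G l) = 0 := by
      simp [Ideal.Quotient.eq_zero_iff_mem.2 (hP l)]
    rw [h0] at this
    rw [mul_eq_zero]; right
    exact this.symm

lemma count_geo [IsAlgClosed K] {m g : ℕ} {G : MvPolynomial (Fin N) K}
    (hG : G.IsHomogeneous (m+1)) (hchar : ((m+1).factorial : K) ≠ 0)
    (hr : rr m g m < homRank (m+1) G) :
    ∃ c : ℕ, ∀ A : Finset K, A.Nonempty →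
      (VF (Ideal.span (Set.range (pl m G))) A).card * A.card ^ g ≤ c * A.card ^ (m * N) := by
  obtain ⟨c, hc⟩ := count_bound g (Ideal.span (Set.range (pl m G))) (by
    intro P hP hle hcon
    have := geo_case hG hchar P (fun l => hle (Ideal.subset_span ⟨l, rfl⟩)) hcon
    omega)
  refine ⟨c, fun A hA => ?_⟩
  simpa using hc A hA

end geo


section fin
variable {N : ℕ} {k : Type*} [Field k] [Fintype k]

lemma dev_bound (m g c : ℕ) (F : MvPolynomial (Fin N) k) (hF : PD (m+2) F)
    (hZ : Nat.card (Zs m F) * Fintype.card k ^ g ≤ c * Fintype.card k ^ (m * N)) (t s : k) :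
    |(Nat.card {v : Fin N → k // eval v F = t} : ℝ) / (Fintype.card k : ℝ) ^ N -
      (Nat.card {v : Fin N → k // eval v F = s} : ℝ) / (Fintype.card k : ℝ) ^ N| ≤
      2 * ((c : ℝ) / (Fintype.card k : ℝ) ^ g) ^ ((1 : ℝ) / 2 ^ m) := by
  have hQ : (0:ℝ) < (Fintype.card k : ℝ) := by exact_mod_cast Fintype.card_pos
  have hcard : (Fintype.card (Fin N → k) : ℝ) = (Fintype.card k : ℝ) ^ N := by simp
  have h : ∀ ψ : AddChar k ℂ, ψ ≠ 1 →
      expS ψ F ≤ ((c : ℝ) / (Fintype.card k : ℝ) ^ g) ^ ((1 : ℝ) / 2 ^ m) := by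
    intro ψ hψ
    have h1 := weyl ψ hψ m F hF
    have h2 : expS ψ F ^ (2^m) ≤ (c : ℝ) / (Fintype.card k : ℝ) ^ g := by
      refine h1.trans ?_
      rw [hcard, div_le_div_iff₀ (by positivity) (by positivity), ← pow_mul, mul_comm N m]
      exact_mod_cast hZ
    have h3 : expS ψ F = (expS ψ F ^ (2^m)) ^ ((1 : ℝ) / 2 ^ m) := by
      rw [← Real.rpow_natCast, ← Real.rpow_mul (expS_nonneg ψ F)]
      simp
    rw [h3]
    exact Real.rpow_le_rpow (pow_nonneg (expS_nonneg ψ F) _) h2 (by positivity)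
  have ht := dev_fourier F _ h t
  have hs := dev_fourier F _ h s
  rw [hcard] at ht hs
  rw [abs_le] at *
  constructor <;> linarith [ht.1, ht.2, hs.1, hs.2]

lemma Zs_card_le {K : Type*} [Field K] (φ : k →+* K) (m : ℕ)
    (F : MvPolynomial (Fin N) k) (G H : MvPolynomial (Fin N) K) (hFG : map φ F = G + H)
    (hH : PD (m+1) H) (A : Finset K) (hA : ∀ x, φ x ∈ A) :
    Nat.card (Zs m F) ≤ (VF (Ideal.span (Set.range (pl m G))) A).card := by
  have hc : (VF (Ideal.span (Set.range (pl m G))) A).card =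
      Nat.card (VF (Ideal.span (Set.range (pl m G))) A) :=
    (Nat.card_eq_fintype_card.trans (Fintype.card_coe _)).symm
  rw [hc]
  refine Nat.card_le_card_of_injective
    (fun w : Zs m F => (⟨fun t => φ (w.1 t.1 t.2), ?_⟩ :
      VF (Ideal.span (Set.range (pl m G))) A)) ?_
  · rw [mem_VF]
    refine ⟨fun i => hA _, ?_⟩
    suffices Ideal.span (Set.range (pl m G)) ≤
        RingHom.ker (eval fun t : Fin m × Fin N => φ (w.1 t.1 t.2)) from fun f hf => this hf
    rw [Ideal.span_le]
    rintro _ ⟨l, rfl⟩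
    change eval _ _ = 0
    rw [pl_hom]
    have e : (eval fun t : Fin m × Fin N => φ (w.1 t.1 t.2)).comp C = RingHom.id K := by
      ext x; simp
    rw [e, map_id]
    simp only [RingHom.id_apply, eval_X]
    have h1 := ML_map φ m F (Pi.single l 1) w.1
    rw [w.2, map_zero, hFG, ML_add, ML_PD m H hH, add_zero] at h1
    rw [← h1]
    congr 2
    funext i
    rcases eq_or_ne i l with rfl | h
    · simp
    · simp [h]
  · intro w w' h
    apply Subtype.ext
    funext j i
    exact φ.injective (congrFun (congrArg Subtype.val h) (j, i))
end fin

section knsec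
variable (p m : ℕ) [Fact p.Prime] (n : ℕ)

instance : CharP (AlgebraicClosure (GaloisField p m)) p :=
  charP_of_injective_algebraMap (algebraMap (GaloisField p m) _).injective p

lemma mem_kn (x : AlgebraicClosure (GaloisField p m)) :
    x ∈ kn p m n ↔ x ^ (p ^ (m * n)) = x := by
  rfl

lemma kn_card (h : m * n ≠ 0) : Nat.card (kn p m n) = p ^ (m * n) := by
  classical
  have hp : 1 < p := (Fact.out : p.Prime).one_lt
  have h1 : 1 < p ^ (m * n) := Nat.one_lt_pow h hp
  have hne : (Polynomial.X ^ (p ^ (m * n)) - Polynomial.X :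
      Polynomial (AlgebraicClosure (GaloisField p m))) ≠ 0 := FiniteField.X_pow_card_sub_X_ne_zero _ h1
  have hsep : (Polynomial.X ^ (p ^ (m * n)) - Polynomial.X :
      Polynomial (AlgebraicClosure (GaloisField p m))).Separable :=
    galois_poly_separable p _ (dvd_pow_self p h)
  have hset : ((kn p m n : Set (AlgebraicClosure (GaloisField p m)))) =
      (Polynomial.X ^ (p ^ (m * n)) - Polynomial.X :
      Polynomial (AlgebraicClosure (GaloisField p m))).rootSet
        (AlgebraicClosure (GaloisField p m)) := by
    ext x
    rw [Polynomial.mem_rootSet_of_ne hne, SetLike.mem_coe, mem_kn]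
    simp [sub_eq_zero]
  have : Nat.card (kn p m n) = Nat.card ((kn p m n : Set (AlgebraicClosure (GaloisField p m)))) := rfl
  rw [this, hset, Nat.card_eq_fintype_card, Polynomial.card_rootSet_eq_natDegree hsep
    (IsAlgClosed.splits _), FiniteField.X_pow_card_sub_X_natDegree_eq _ h1]

lemma alg_mem_kn (hm : m ≠ 0) (x : GaloisField p m) :
    algebraMap (GaloisField p m) (AlgebraicClosure (GaloisField p m)) x ∈ kn p m n := by
  rw [mem_kn, ← map_pow]
  congr 1
  let _ := Fintype.ofFinite (GaloisField p m)
  have h1 : x ^ (p ^ m) = x := by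
    have := FiniteField.pow_card x
    rwa [← Nat.card_eq_fintype_card, GaloisField.card p m hm] at this
  rw [pow_mul]
  induction n with
  | zero => simp
  | succ n ih => rw [pow_succ, pow_mul, ih, h1]

end knsec


section final

lemma mu_bound {p m₀ N m g : ℕ} [Fact p.Prime] (hm₀ : 1 ≤ m₀) (hp : m + 1 < p)
    (F : MvPolynomial (Fin N) (GaloisField p m₀)) (hF : F.totalDegree = m + 1)
    (hr : rr m g m < polyRank (m+1) F) :
    ∃ c : ℕ, 1 ≤ c ∧ ∀ n : ℕ, 1 ≤ n → ∀ t s : kn p m₀ n, |muF F n t - muF F n s| ≤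
      2 * ((c : ℝ) / ((p : ℝ) ^ (m₀ * n)) ^ g) ^ ((1 : ℝ) / 2 ^ m) := by
  classical
  let K := AlgebraicClosure (GaloisField p m₀)
  let alg := algebraMap (GaloisField p m₀) K
  let G : MvPolynomial (Fin N) K := map alg (homogeneousComponent (m+1) F)
  have hG : G.IsHomogeneous (m+1) := (homogeneousComponent_isHomogeneous (m+1) F).map alg
  have hchar : ((m+1).factorial : K) ≠ 0 := by
    rw [Ne, CharP.cast_eq_zero_iff K p, (Fact.out : p.Prime).dvd_factorial]
    omega
  obtain ⟨c, hc⟩ := count_geo (g := g) hG hchar hr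
  refine ⟨c + 1, by omega, fun n hn t s => ?_⟩
  have hmn : m₀ * n ≠ 0 := by positivity
  have hcard := kn_card p m₀ n hmn
  have hfin : Finite (kn p m₀ n) := Nat.finite_of_card_ne_zero (by
    rw [hcard]; exact pow_ne_zero _ (Fact.out : p.Prime).ne_zero)
  let _ := Fintype.ofFinite (kn p m₀ n)
  rw [Nat.card_eq_fintype_card] at hcard
  let ι : GaloisField p m₀ →+* kn p m₀ n :=
    alg.codRestrict (kn p m₀ n) (alg_mem_kn p m₀ n (by omega))
  let φ : kn p m₀ n →+* K := (kn p m₀ n).subtype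
  let Fn := map ι F
  have hφι : map φ Fn = map alg F := by
    change map φ (map ι F) = _
    rw [map_map]
    rfl
  have hFn : PD (m+2) Fn := by
    rw [PD_iff]
    intro u hu
    have hu' : coeff u F ≠ 0 := by
      intro h0; apply hu
      change coeff u (map ι F) = 0
      rw [coeff_map, h0, map_zero]
    have := le_totalDegree (mem_support_iff.2 hu')
    rw [hF] at this
    have e : u.degree = u.sum fun _ e => e := rfl
    omega
  let A : Finset K := Finset.univ.image φ
  have hAcard : A.card = p ^ (m₀ * n) := by
    rw [Finset.card_image_of_injective _ φ.injective, Finset.card_univ, hcard]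
  have hZ1 := Zs_card_le φ m Fn G (map alg F - G) (by rw [hφι]; ring) (by
    rw [PD_iff]
    intro u hu
    rw [coeff_sub, coeff_map, coeff_map, coeff_homogeneousComponent] at hu
    by_cases h : u.degree = m + 1
    · rw [if_pos h, sub_self] at hu; exact absurd rfl hu
    · rw [if_neg h, map_zero, sub_zero] at hu
      have hu' : coeff u F ≠ 0 := by
        intro h0; apply hu; rw [h0, map_zero]
      have := le_totalDegree (mem_support_iff.2 hu')
      rw [hF] at this
      have e : u.degree = u.sum fun _ e => e := rfl
      omega) A (fun x => Finset.mem_image_of_mem _ (Finset.mem_univ _))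
  have hZ2 := hc A ⟨φ 0, Finset.mem_image_of_mem _ (Finset.mem_univ _)⟩
  rw [hAcard] at hZ2
  have hZ : Nat.card (Zs m Fn) * Fintype.card (kn p m₀ n) ^ g ≤
      (c + 1) * Fintype.card (kn p m₀ n) ^ (m * N) := by
    rw [hcard]
    refine (Nat.mul_le_mul_right _ hZ1).trans (hZ2.trans ?_)
    gcongr
    omega
  have hb := dev_bound m g (c+1) Fn hFn hZ t s
  have hmu : ∀ t : kn p m₀ n, muF F n t =
      (Nat.card {v : Fin N → kn p m₀ n // eval v Fn = t} : ℝ) /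
        (Fintype.card (kn p m₀ n) : ℝ) ^ N := by
    intro t
    unfold muF
    rw [hcard]
    congr 1
    · congr 1
      refine Nat.card_congr (Equiv.subtypeEquivRight fun v => ?_)
      have : eval (fun i => φ (v i)) (map alg F) = φ (eval v Fn) := by
        rw [← hφι, eval_map, eval₂_comp]
        rfl
      change eval (fun i => φ (v i)) (map alg F) = φ t ↔ _
      rw [this]
      exact φ.injective.eq_iff
    · push_cast
      rw [← pow_mul]
  rw [hmu, hmu]
  refine hb.trans ?_
  rw [hcard]
  push_cast
  exact le_rfl

theorem bias_le_of_eventually {p m N : ℕ} [Fact p.Prime]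
    (F : MvPolynomial (Fin N) (GaloisField p m)) (b : ℝ) (hb : 0 < b)
    (h : ∀ᶠ n in Filter.atTop, (biasSeq F n)⁻¹ ≤ b) : bias F ≤ b := by
  unfold bias
  rw [Filter.limsup_eq]
  by_cases hB : BddBelow {a | ∀ᶠ n in Filter.atTop, (biasSeq F n)⁻¹ ≤ a}
  · exact csInf_le hB h
  · rw [Real.sInf_of_not_bddBelow hB]; exact hb.le

theorem statement0 (b : ℝ) (hb : 0 < b) (d : ℕ) (hd : 2 ≤ d) :
    ∃ c : ℝ, ∀ (p : ℕ) [Fact p.Prime], d < p → ∀ m : ℕ, 1 ≤ m →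
      ∀ N : ℕ, 1 ≤ N → ∀ F : MvPolynomial (Fin N) (GaloisField p m),
        F.totalDegree = d → c < (polyRank d F : ℝ) → bias F ≤ b := by
  obtain ⟨m, rfl⟩ : ∃ m, d = m + 1 := ⟨d - 1, by omega⟩
  obtain ⟨g, hg⟩ := exists_nat_gt ((2:ℝ)^m / b)
  refine ⟨rr m g m, fun p _ hp m₀ hm₀ N hN F hF hr => ?_⟩
  obtain ⟨c, hc1, hc⟩ := mu_bound (g := g) hm₀ hp F hF (by exact_mod_cast hr)
  apply bias_le_of_eventually F b hb
  have hp1 : (1:ℝ) < p := by exact_mod_cast (Fact.out : p.Prime).one_lt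
  have hlogp : 0 < Real.log p := Real.log_pos hp1
  set κ : ℝ := (g - 2^m / b) / 2^m * Real.log p with hκ
  have hκ0 : 0 < κ := by
    have : 0 < (g:ℝ) - 2^m / b := by linarith
    positivity
  obtain ⟨n₀, hn₀⟩ := exists_nat_gt ((Real.log 2 + Real.log c / 2^m) / κ)
  filter_upwards [Filter.eventually_ge_atTop (max n₀ 1)] with n hn
  have hn1 : 1 ≤ n := le_trans (le_max_right _ _) hn
  have hnn : n₀ ≤ n := le_trans (le_max_left _ _) hn
  set Q : ℝ := (p : ℝ) ^ (m₀ * n) with hQ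
  have hlogQ : Real.log Q = (m₀ * n : ℝ) * Real.log p := by
    rw [hQ, Real.log_pow]; push_cast; rfl
  have hm0' : (1:ℝ) ≤ m₀ := by exact_mod_cast hm₀
  have hn1' : (1:ℝ) ≤ n := by exact_mod_cast hn1
  have hQpos : 0 < Q := by positivity
  have hlogQ0 : 0 < Real.log Q := by rw [hlogQ]; positivity
  unfold biasSeq
  set M : ℝ := ⨆ t : kn p m₀ n, ⨆ s : kn p m₀ n, |muF F n t - muF F n s| with hM
  have hM0 : 0 ≤ M := Real.iSup_nonneg fun t => Real.iSup_nonneg fun s => abs_nonneg _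
  have hM1 : M ≤ 2 * ((c : ℝ) / Q ^ g) ^ ((1 : ℝ) / 2 ^ m) :=
    ciSup_le fun t => ciSup_le fun s => hc n hn1 t s
  rcases hM0.eq_or_lt with h0 | hpos
  · rw [← h0]; simp [hb.le]
  have hcpos : (0:ℝ) < c := by exact_mod_cast hc1
  have hlog := Real.log_le_log hpos hM1
  rw [Real.log_mul (by norm_num) (by positivity), Real.log_rpow (by positivity),
    Real.log_div hcpos.ne' (by positivity), Real.log_pow] at hlog
  have hkey : b⁻¹ ≤ -Real.logb Q M := by
    rw [Real.logb, ← neg_div, le_div_iff₀ hlogQ0]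
    have h1 : Real.log 2 + Real.log c / 2^m < κ * n := by
      rw [div_lt_iff₀ hκ0] at hn₀
      have : (n₀:ℝ) ≤ n := by exact_mod_cast hnn
      nlinarith
    have h2 : κ * n ≤ (g - 2^m / b) / 2^m * Real.log Q := by
      have h3 : (0:ℝ) ≤ κ * n := by positivity
      have h4 : (g - 2^m / b) / 2^m * Real.log Q = (κ * n) * m₀ := by
        rw [hlogQ, hκ]; ring
      rw [h4]
      nlinarith
    have h5 : (g - 2^m / b) / 2^m * Real.log Q = 1 / 2^m * (g * Real.log Q) - b⁻¹ * Real.log Q := by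
      field_simp
    have h6 : 1 / 2 ^ m * (Real.log c - g * Real.log Q) =
        Real.log c / 2^m - 1 / 2^m * (g * Real.log Q) := by ring
    rw [h6] at hlog
    linarith
  exact inv_le_of_inv_le₀ hb hkey

end final
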